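/- arXiv:0705.2168 — 7 statements merged into one kernel-verified Lean document; each statement's English description precedes it below -/
import Mathlib

section
/- Let (X, v, v*) and (Y, w, w*) be two regular triples. Then there exists g ∈ GL(V) with g∘X∘g⁻¹ = Y, g(v) = w and w* = v*∘g⁻¹ if and only if q_j(X, v, v*) = q_j(Y, w, w*) for every j ∈ ℕ and X and Y have the same characteristic polynomial. -/
/-- `(X, v, v*)` is a *regular* triple: `(v, Xv, …, X^{n−1}v)` is a basis of `V` and
`(v*, v*∘X, …, v*∘X^{n−1})` is a basis of the dual space `V*`. -/
def RegularTriple (F : Type*) {V : Type*} [Field F] [AddCommGroup V] [Module F V]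
    (n : ℕ) (X : V →ₗ[F] V) (v : V) (vs : Module.Dual F V) : Prop :=
  (LinearIndependent F (fun i : Fin n => (X ^ (i : ℕ)) v) ∧
    Submodule.span F (Set.range fun i : Fin n => (X ^ (i : ℕ)) v) = ⊤) ∧
  (LinearIndependent F (fun i : Fin n => (vs ∘ₗ X ^ (i : ℕ) : Module.Dual F V)) ∧
    Submodule.span F (Set.range fun i : Fin n => (vs ∘ₗ X ^ (i : ℕ) : Module.Dual F V)) = ⊤)

open Polynomial in
/-- If `X` and `Y` have the same characteristic polynomial, a linear map sending `X ^ i v` to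
`Y ^ i w` for all `i` below the dimension does so for all `i`. -/
theorem LinearMap.map_pow_apply_of_charpoly_eq {F V W : Type*} [Field F]
    [AddCommGroup V] [Module F V] [FiniteDimensional F V]
    [AddCommGroup W] [Module F W] [FiniteDimensional F W]
    {X : V →ₗ[F] V} {Y : W →ₗ[F] W} (hXY : X.charpoly = Y.charpoly) {v : V} {w : W}
    (g : V →ₗ[F] W) (hg : ∀ i < Module.finrank F V, g ((X ^ i) v) = (Y ^ i) w) (k : ℕ) :
    g ((X ^ k) v) = (Y ^ k) w := by
  rw [X.pow_eq_aeval_mod_charpoly k, Y.pow_eq_aeval_mod_charpoly k, ← hXY]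
  have hdeg : ((Polynomial.X : F[X]) ^ k %ₘ X.charpoly).degree < Module.finrank F V := by
    rw [← X.charpoly_natDegree, ← degree_eq_natDegree X.charpoly_monic.ne_zero]
    exact degree_modByMonic_lt _ X.charpoly_monic
  rw [as_sum_support (_ %ₘ _)]
  simp only [map_sum, LinearMap.sum_apply, aeval_monomial, Module.End.mul_apply,
    Module.algebraMap_end_apply, map_smul]
  refine Finset.sum_congr rfl fun i hi => ?_
  have hi' : (i : WithBot ℕ) < Module.finrank F V :=
    (le_degree_of_mem_supp i hi).trans_lt hdeg
  rw [hg i (by exact_mod_cast hi')]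

/-- Two regular triples `(X, v, v*)` and `(Y, w, w*)` are conjugate under `GL(V)`
(i.e. there is `g ∈ GL(V)` with `g∘X∘g⁻¹ = Y`, `g(v) = w`, `w* = v*∘g⁻¹`) if and only if
`q_j(X, v, v*) = q_j(Y, w, w*)` for all `j ∈ ℕ` and `X`, `Y` have the same characteristic
polynomial. -/
theorem statement1 {F V : Type*} [Field F] [AddCommGroup V] [Module F V]
    [FiniteDimensional F V] {n : ℕ} (hn : 1 ≤ n) (hdim : Module.finrank F V = n)
    (X Y : V →ₗ[F] V) (v w : V) (vs ws : Module.Dual F V)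
    (hX : RegularTriple F n X v vs) (hY : RegularTriple F n Y w ws) :
    (∃ g : V ≃ₗ[F] V,
        g.toLinearMap ∘ₗ X ∘ₗ g.symm.toLinearMap = Y ∧ g v = w ∧
          ws = vs ∘ₗ g.symm.toLinearMap) ↔
      ((∀ j : ℕ, vs ((X ^ j) v) = ws ((Y ^ j) w)) ∧ X.charpoly = Y.charpoly) := by
  constructor
  · rintro ⟨g, rfl, rfl, rfl⟩
    refine ⟨fun j => ?_, (g.charpoly_conj X).symm⟩
    have hpow : (g.conj X) ^ j = g.conj (X ^ j) := (map_pow (g.conjAlgEquiv F) X j).symm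
    change _ = vs (g.symm (((g.conj X) ^ j) (g v)))
    rw [hpow]
    simp [LinearEquiv.conj_apply]
  · rintro ⟨hq, hchar⟩
    let bX := Module.Basis.mk hX.1.1 hX.1.2.ge
    let bY := Module.Basis.mk hY.1.1 hY.1.2.ge
    let g : V ≃ₗ[F] V := bX.equiv bY (Equiv.refl _)
    have hbX (i) : bX i = (X ^ (i : ℕ)) v := Module.Basis.mk_apply ..
    have hbY (i) : bY i = (Y ^ (i : ℕ)) w := Module.Basis.mk_apply ..
    have hpow : ∀ k, g ((X ^ k) v) = (Y ^ k) w :=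
      LinearMap.map_pow_apply_of_charpoly_eq hchar g.toLinearMap fun i hi => by
        have h : g (bX ⟨i, hdim ▸ hi⟩) = bY ⟨i, hdim ▸ hi⟩ := bX.equiv_apply _ _ _
        rwa [hbX, hbY] at h
    have hcomm : g.toLinearMap ∘ₗ X = Y ∘ₗ g.toLinearMap := bX.ext fun i => by
      have h := hpow (i + 1)
      rw [pow_succ', pow_succ', Module.End.mul_apply, Module.End.mul_apply, ← hpow] at h
      simpa [hbX] using h
    have hdual : ws ∘ₗ g.toLinearMap = vs := bX.ext fun i => by
      simp [hbX, hpow, hq]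
    refine ⟨g, ?_, by simpa using hpow 0, ?_⟩
    · rw [← LinearMap.comp_assoc, hcomm]
      ext x
      simp
    · rw [← hdual]
      ext x
      simp
end

section
/- Let (X, v, v*) ∈ End(V) × V × V*. The triple (X, v, v*) is regular if and only if its GL(V)-orbit {(g∘X∘g⁻¹, g(v), v*∘g⁻¹) : g ∈ GL(V)} is a closed subset of End(V) × V × V* and the stabilizer {g ∈ GL(V) : g∘X∘g⁻¹ = X, g(v) = v, v*∘g⁻¹ = v*} is reduced to the identity. -/
section Observability

variable {F V : Type*} [Field F] [AddCommGroup V] [Module F V]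

/-- The observation map `u ↦ (v*(Xⁱ u))ᵢ`. -/
def observation (X : V →ₗ[F] V) (vs : Module.Dual F V) : V →ₗ[F] (ℕ → F) :=
  LinearMap.pi fun i => vs ∘ₗ X ^ i

@[simp]
theorem observation_apply (X : V →ₗ[F] V) (vs : Module.Dual F V) (u : V) (i : ℕ) :
    observation X vs u i = vs ((X ^ i) u) := rfl

theorem observation_map (X : V →ₗ[F] V) (vs : Module.Dual F V) (u : V) (i : ℕ) :
    observation X vs (X u) i = observation X vs u (i + 1) := by
  simp [pow_succ]

theorem observation_pow (X : V →ₗ[F] V) (vs : Module.Dual F V) (u : V) (i j : ℕ) :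
    observation X vs ((X ^ j) u) i = vs ((X ^ (i + j)) u) := by
  simp [pow_add]

theorem RegularTriple.span_range_pow {n : ℕ} {X : V →ₗ[F] V} {v : V} {vs : Module.Dual F V}
    (h : RegularTriple F n X v vs) :
    Submodule.span F (Set.range fun i : ℕ => (X ^ i) v) = ⊤ := by
  rw [eq_top_iff, ← h.1.2]
  exact Submodule.span_mono (Set.range_subset_iff.mpr fun i => ⟨i, rfl⟩)

variable [FiniteDimensional F V]

theorem pow_mem_span_pow_lt_finrank (X : V →ₗ[F] V) (k : ℕ) :
    X ^ k ∈ Submodule.span F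
      (Set.range fun i : Fin (Module.finrank F V) => X ^ (i : ℕ)) := by
  rcases Nat.eq_zero_or_pos (Module.finrank F V) with h0 | hpos
  · have : Subsingleton V := Module.finrank_zero_iff.mp h0
    rw [Subsingleton.elim (X ^ k) 0]
    exact Submodule.zero_mem _
  rw [LinearMap.pow_eq_aeval_mod_charpoly, Polynomial.aeval_eq_sum_range'
    (n := Module.finrank F V)]
  · exact Submodule.sum_mem _ fun i hi => Submodule.smul_mem _ _
      (Submodule.subset_span ⟨⟨i, Finset.mem_range.mp hi⟩, rfl⟩)
  · rw [← LinearMap.charpoly_natDegree X]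
    refine Polynomial.natDegree_modByMonic_lt _ (LinearMap.charpoly_monic X) fun h => ?_
    have := LinearMap.charpoly_natDegree X
    rw [h, Polynomial.natDegree_one] at this
    omega

theorem RegularTriple.ker_observation {n : ℕ} {X : V →ₗ[F] V} {v : V} {vs : Module.Dual F V}
    (h : RegularTriple F n X v vs) : LinearMap.ker (observation X vs) = ⊥ := by
  rw [Submodule.eq_bot_iff]
  intro u hu
  refine (Module.forall_dual_apply_eq_zero_iff F u).mp fun φ => ?_
  have hφ : φ ∈ Submodule.span F
      (Set.range fun i : Fin n => (vs ∘ₗ X ^ (i : ℕ) : Module.Dual F V)) :=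
    h.2.2 ▸ Submodule.mem_top
  induction hφ using Submodule.span_induction with
  | mem x hx =>
    obtain ⟨i, rfl⟩ := hx
    exact congrFun (LinearMap.mem_ker.mp hu) i
  | zero => rfl
  | add x y _ _ hx hy => simp [hx, hy]
  | smul a x _ hx => simp [hx]

theorem regularTriple_of_span_eq_top_of_ker_eq_bot {X : V →ₗ[F] V} {v : V}
    {vs : Module.Dual F V}
    (hspan : Submodule.span F (Set.range fun i : ℕ => (X ^ i) v) = ⊤)
    (hker : LinearMap.ker (observation X vs) = ⊥) :
    RegularTriple F (Module.finrank F V) X v vs := by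
  have h1 : Submodule.span F
      (Set.range fun i : Fin (Module.finrank F V) => (X ^ (i : ℕ)) v) = ⊤ := by
    rw [eq_top_iff, ← hspan, Submodule.span_le]
    rintro _ ⟨k, rfl⟩
    have := Submodule.mem_map_of_mem (f := LinearMap.applyₗ (R := F) (M₂ := V) v)
      (pow_mem_span_pow_lt_finrank X k)
    rw [Submodule.map_span, ← Set.range_comp] at this
    exact this
  have h2 : Submodule.span F (Set.range fun i : Fin (Module.finrank F V) =>
      (vs ∘ₗ X ^ (i : ℕ) : Module.Dual F V)) = ⊤ := by
    set S := Submodule.span F (Set.range fun i : Fin (Module.finrank F V) =>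
      (vs ∘ₗ X ^ (i : ℕ) : Module.Dual F V)) with hS
    have hmem (k : ℕ) : (vs ∘ₗ X ^ k : Module.Dual F V) ∈ S := by
      have := Submodule.mem_map_of_mem (f := LinearMap.compRight F (M := V) vs)
        (pow_mem_span_pow_lt_finrank X k)
      rw [Submodule.map_span, ← Set.range_comp] at this
      exact this
    have hco : S.dualCoannihilator = ⊥ := by
      rw [eq_bot_iff, ← hker]
      intro u hu
      rw [LinearMap.mem_ker]
      ext k
      exact (Submodule.mem_dualCoannihilator _).mp hu _ (hmem k)
    rw [← Subspace.dualCoannihilator_dualAnnihilator_eq (W := S), hco,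
      Submodule.dualAnnihilator_bot]
  exact ⟨⟨linearIndependent_of_top_le_span_of_card_eq_finrank h1.ge (by simp), h1⟩,
    linearIndependent_of_top_le_span_of_card_eq_finrank h2.ge
      (by simp [Subspace.dual_finrank_eq]), h2⟩

/-- A regular triple is determined up to conjugation by the invariants `v*(Xⁱ v)`. -/
theorem RegularTriple.exists_linearEquiv {n : ℕ} {X Y : V →ₗ[F] V} {v w : V}
    {vs ws : Module.Dual F V} (h : RegularTriple F n X v vs)
    (hinv : ∀ i : ℕ, ws ((Y ^ i) w) = vs ((X ^ i) v)) :
    ∃ g : V ≃ₗ[F] V, (∀ u, g (X u) = Y (g u)) ∧ g v = w ∧ ∀ u, ws (g u) = vs u := by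
  set L := observation X vs with hL
  set M := observation Y ws with hM
  have hLinj : LinearMap.ker L = ⊥ := h.ker_observation
  have hpow (j : ℕ) : L ((X ^ j) v) = M ((Y ^ j) w) := by
    ext i
    rw [hL, hM, observation_pow, observation_pow, hinv]
  have hle : LinearMap.range L ≤ LinearMap.range M := by
    rw [LinearMap.range_eq_map, ← h.span_range_pow, Submodule.map_span, Submodule.span_le]
    rintro _ ⟨_, ⟨j, rfl⟩, rfl⟩
    exact ⟨(Y ^ j) w, (hpow j).symm⟩
  have hrankL : Module.finrank F (LinearMap.range L) = Module.finrank F V :=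
    LinearMap.finrank_range_of_inj (LinearMap.ker_eq_bot.mp hLinj)
  have hrange : LinearMap.range L = LinearMap.range M :=
    Submodule.eq_of_le_of_finrank_le hle (hrankL ▸ LinearMap.finrank_range_le M)
  have hMinj : LinearMap.ker M = ⊥ := by
    have := LinearMap.finrank_range_add_finrank_ker M
    rw [← hrange, hrankL] at this
    exact Submodule.finrank_eq_zero.mp (by omega)
  let g : V ≃ₗ[F] V := (LinearEquiv.ofInjective L (LinearMap.ker_eq_bot.mp hLinj)).trans
    ((LinearEquiv.ofEq _ _ hrange).trans
      (LinearEquiv.ofInjective M (LinearMap.ker_eq_bot.mp hMinj)).symm)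
  have hg (u : V) : M (g u) = L u := by
    have : LinearEquiv.ofInjective M (LinearMap.ker_eq_bot.mp hMinj) (g u) =
        LinearEquiv.ofEq _ _ hrange
          (LinearEquiv.ofInjective L (LinearMap.ker_eq_bot.mp hLinj) u) := by
      simp [g]
    exact congrArg Subtype.val this
  refine ⟨g, fun u => LinearMap.ker_eq_bot.mp hMinj ?_, LinearMap.ker_eq_bot.mp hMinj ?_,
    fun u => ?_⟩
  · rw [hg]
    ext i
    rw [hL, hM, observation_map, observation_map, ← hL, ← hM, hg]
  · rw [hg]
    exact hpow 0
  · exact congrFun (hg u) 0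

end Observability

section Dilation

variable {F V : Type*} [NontriviallyNormedField F] [NormedAddCommGroup V] [NormedSpace F V]

/-- The automorphism acting as `t` on the range of an idempotent `P` and as the identity on its
kernel. -/
def dilation (P : V →L[F] V) (hP : ∀ u, P (P u) = P u) (t : F) (ht : t ≠ 0) : V ≃L[F] V :=
  ContinuousLinearEquiv.equivOfInverse
    (ContinuousLinearMap.id F V - P + t • P) (ContinuousLinearMap.id F V - P + t⁻¹ • P)
    (fun u => by simp [hP, smul_smul, ht]) (fun u => by simp [hP, smul_smul, ht])

theorem dilation_apply (P : V →L[F] V) (hP : ∀ u, P (P u) = P u) (t : F) (ht : t ≠ 0) (u : V) :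
    dilation P hP t ht u = u - P u + t • P u := rfl

theorem dilation_symm_apply (P : V →L[F] V) (hP : ∀ u, P (P u) = P u) (t : F) (ht : t ≠ 0)
    (u : V) : (dilation P hP t ht).symm u = u - P u + t⁻¹ • P u := rfl

theorem eq_zero_of_dilation_eq_refl {P : V →L[F] V} {hP : ∀ u, P (P u) = P u} {t : F}
    {ht : t ≠ 0} (ht1 : t ≠ 1)
    (h : dilation P hP t ht = ContinuousLinearEquiv.refl F V) (u : V) : P u = 0 := by
  have h1 : u - P u + t • P u = u := DFunLike.congr_fun h u
  have h2 : (t - 1) • P u = 0 := by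
    rw [sub_smul, one_smul, ← sub_eq_zero.mpr h1]
    abel
  exact (smul_eq_zero.mp h2).resolve_left (sub_ne_zero.mpr ht1)

theorem exists_projection [CompleteSpace F] [FiniteDimensional F V] (S : Submodule F V) :
    ∃ P : V →L[F] V, (∀ u ∈ S, P u = u) ∧ ∀ u, P u ∈ S := by
  obtain ⟨f, hf⟩ := S.subtype.exists_leftInverse_of_injective S.ker_subtype
  refine ⟨LinearMap.toContinuousLinearMap (S.subtype ∘ₗ f), fun u hu => ?_, fun u => ?_⟩
  · have := LinearMap.congr_fun hf ⟨u, hu⟩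
    simpa using congrArg Subtype.val this
  · simp

end Dilation

section Orbit

open Filter Topology

variable {F V : Type*} [NontriviallyNormedField F] [NormedAddCommGroup V] [NormedSpace F V]

/-- The action of `GL(V)` on triples. -/
def tripleConj (g : V ≃L[F] V) (p : (V →L[F] V) × V × (V →L[F] F)) :
    (V →L[F] V) × V × (V →L[F] F) :=
  ((g : V →L[F] V).comp (p.1.comp (g.symm : V →L[F] V)), g p.2.1,
    p.2.2.comp (g.symm : V →L[F] V))

/-- If an orbit is closed with trivial stabilizer, then any point in its closure also has trivial
stabilizer. -/
theorem eq_refl_of_tendsto_tripleConj {p q : (V →L[F] V) × V × (V →L[F] F)}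
    (hclosed : IsClosed {x | ∃ g : V ≃L[F] V, x = tripleConj g p})
    (hstab : ∀ g : V ≃L[F] V, tripleConj g p = p → g = ContinuousLinearEquiv.refl F V)
    {γ : F → (V →L[F] V) × V × (V →L[F] F)} (hγ : Tendsto γ (𝓝[≠] 0) (𝓝 q))
    (hmem : ∀ t, t ≠ 0 → ∃ g : V ≃L[F] V, γ t = tripleConj g p)
    {h : V ≃L[F] V} (hq : tripleConj h q = q) : h = ContinuousLinearEquiv.refl F V := by
  obtain ⟨g, rfl⟩ := hclosed.mem_of_tendsto hγ
    (eventually_mem_nhdsWithin.mono fun t ht => hmem t ht)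
  have key : (g.trans h).trans g.symm = ContinuousLinearEquiv.refl F V := by
    apply hstab
    simp only [tripleConj, Prod.ext_iff] at hq
    obtain ⟨h1, h2, h3⟩ := hq
    refine Prod.ext ?_ (Prod.ext ?_ ?_)
    · ext u
      have := DFunLike.congr_fun h1 (g u)
      simp only [ContinuousLinearMap.comp_apply, ContinuousLinearEquiv.coe_coe,
        ContinuousLinearEquiv.symm_apply_apply] at this
      simp [tripleConj, this]
    · simp [tripleConj, h2]
    · ext u
      have := DFunLike.congr_fun h3 (g u)
      simpa [tripleConj] using this
  ext u
  have := DFunLike.congr_fun key (g.symm u)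
  simpa using this

variable [CompleteSpace F] [FiniteDimensional F V]

/-- A triple with closed orbit and trivial stabilizer has no proper invariant subspace
containing `v`. -/
theorem eq_top_of_isClosed_orbit [CharZero F] {X : V →L[F] V} {v : V} {vs : V →L[F] F}
    (hclosed : IsClosed {x | ∃ g : V ≃L[F] V, x = tripleConj g (X, v, vs)})
    (hstab : ∀ g : V ≃L[F] V, tripleConj g (X, v, vs) = (X, v, vs) →
      g = ContinuousLinearEquiv.refl F V)
    {U : Submodule F V} (hX : ∀ u ∈ U, X u ∈ U) (hv : v ∈ U) : U = ⊤ := by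
  obtain ⟨Q, hQ, hQU⟩ := exists_projection U
  let P : V →L[F] V := ContinuousLinearMap.id F V - Q
  have hPa (u : V) : P u = u - Q u := rfl
  have hPU {u : V} (hu : u ∈ U) : P u = 0 := by rw [hPa, hQ u hu, sub_self]
  have hP (u : V) : P (P u) = P u := by
    rw [hPa u, map_sub, hPU (hQU u), sub_zero, hPa]
  have hPX (u : V) : P (X (P u)) = P (X u) := by
    rw [hPa u, map_sub, map_sub, hPU (hX _ (hQU u)), sub_zero]
  let A : V →L[F] V := X - X.comp P + P.comp X
  let B : V →L[F] V := X.comp P - P.comp X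
  let γ : F → (V →L[F] V) × V × (V →L[F] F) := fun t =>
    (A + t • B, v, vs - vs.comp P + t • vs.comp P)
  have hcont : Continuous γ := by fun_prop
  have h2 : (2 : F) ≠ 0 := two_ne_zero
  have href := eq_refl_of_tendsto_tripleConj hclosed hstab
    (hcont.continuousAt.tendsto.mono_left nhdsWithin_le_nhds) (h := dilation P hP 2 h2)
    (fun t ht => ⟨dilation P hP t⁻¹ (inv_ne_zero ht), by
      refine Prod.ext ?_ (Prod.ext ?_ ?_)
      · ext u
        simp [γ, A, B, tripleConj, dilation_apply, dilation_symm_apply, hPX, ht, smul_smul]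
        module
      · simp [γ, tripleConj, dilation_apply, hPU hv]
      · ext u
        simp [γ, tripleConj, dilation_symm_apply]⟩) (by
      refine Prod.ext ?_ (Prod.ext ?_ ?_)
      · ext u
        simp [γ, A, tripleConj, dilation_apply, dilation_symm_apply, hP, hPX, smul_smul]
        module
      · simp [γ, tripleConj, dilation_apply, hPU hv]
      · ext u
        simp [γ, tripleConj, dilation_symm_apply, hP])
  rw [eq_top_iff]
  intro u _
  have := eq_zero_of_dilation_eq_refl (by norm_num) href u
  rw [hPa, sub_eq_zero] at this
  exact this ▸ hQU u

/-- A triple with closed orbit and trivial stabilizer has no nonzero invariant subspace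
contained in the kernel of `v*`. -/
theorem eq_bot_of_isClosed_orbit [CharZero F] {X : V →L[F] V} {v : V} {vs : V →L[F] F}
    (hclosed : IsClosed {x | ∃ g : V ≃L[F] V, x = tripleConj g (X, v, vs)})
    (hstab : ∀ g : V ≃L[F] V, tripleConj g (X, v, vs) = (X, v, vs) →
      g = ContinuousLinearEquiv.refl F V)
    {W : Submodule F V} (hX : ∀ u ∈ W, X u ∈ W) (hvs : ∀ u ∈ W, vs u = 0) : W = ⊥ := by
  obtain ⟨P, hPW, hPm⟩ := exists_projection W
  have hP (u : V) : P (P u) = P u := hPW _ (hPm u)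
  have hPX (u : V) : P (X (P u)) = X (P u) := hPW _ (hX _ (hPm u))
  have hvsP (u : V) : vs (P u) = 0 := hvs _ (hPm u)
  let A : V →L[F] V := X + X.comp P - P.comp X
  let B : V →L[F] V := P.comp X - X.comp P
  let γ : F → (V →L[F] V) × V × (V →L[F] F) := fun t =>
    (A + t • B, v - P v + t • P v, vs)
  have hcont : Continuous γ := by fun_prop
  have h2 : (2 : F) ≠ 0 := two_ne_zero
  have href := eq_refl_of_tendsto_tripleConj hclosed hstab
    (hcont.continuousAt.tendsto.mono_left nhdsWithin_le_nhds) (h := dilation P hP 2 h2)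
    (fun t ht => ⟨dilation P hP t ht, by
      refine Prod.ext ?_ (Prod.ext ?_ ?_)
      · ext u
        simp [γ, A, B, tripleConj, dilation_apply, dilation_symm_apply, hPX, ht, smul_smul]
        module
      · simp [γ, tripleConj, dilation_apply]
      · ext u
        simp [γ, tripleConj, dilation_symm_apply, hvsP]⟩) (by
      refine Prod.ext ?_ (Prod.ext ?_ ?_)
      · ext u
        simp [γ, A, tripleConj, dilation_apply, dilation_symm_apply, hP, hPX, smul_smul]
        module
      · simp [γ, tripleConj, dilation_apply, hP]
      · ext u
        simp [γ, tripleConj, dilation_symm_apply, hvsP])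
  rw [Submodule.eq_bot_iff]
  intro u hu
  rw [← hPW u hu]
  exact eq_zero_of_dilation_eq_refl (by norm_num) href u

end Orbit

section Regular

variable {F V : Type*} [NontriviallyNormedField F] [NormedAddCommGroup V] [NormedSpace F V]

theorem tripleConj_invariant (g : V ≃L[F] V) (p : (V →L[F] V) × V × (V →L[F] F)) (i : ℕ) :
    (tripleConj g p).2.2 (((tripleConj g p).1 ^ i) (tripleConj g p).2.1) =
      p.2.2 ((p.1 ^ i) p.2.1) := by
  have h : ((tripleConj g p).1 ^ i) (g p.2.1) = g ((p.1 ^ i) p.2.1) := by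
    induction i with
    | zero => simp
    | succ i ih =>
      rw [pow_succ', pow_succ', mul_apply_eq_comp, ih]
      simp [tripleConj]
  change p.2.2 (g.symm (((tripleConj g p).1 ^ i) (g p.2.1))) = _
  rw [h, g.symm_apply_apply]

variable {n : ℕ} {X : V →L[F] V} {v : V} {vs : V →L[F] F}

theorem RegularTriple.eq_refl_of_tripleConj_eq
    (h : RegularTriple F n X.toLinearMap v (vs.toLinearMap : Module.Dual F V))
    {g : V ≃L[F] V} (hg : tripleConj g (X, v, vs) = (X, v, vs)) :
    g = ContinuousLinearEquiv.refl F V := by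
  simp only [tripleConj, Prod.ext_iff] at hg
  obtain ⟨hX, hv, -⟩ := hg
  have hcomm (u : V) : g (X u) = X (g u) := by
    have := DFunLike.congr_fun hX (g u)
    simpa using this
  have hlin : g.toLinearEquiv.toLinearMap = LinearMap.id := by
    refine LinearMap.ext_on h.span_range_pow ?_
    rintro _ ⟨i, rfl⟩
    change g ((X.toLinearMap ^ i) v) = (X.toLinearMap ^ i) v
    induction i with
    | zero => simpa using hv
    | succ i ih =>
      rw [pow_succ', Module.End.mul_apply]
      exact (hcomm _).trans (congrArg X ih)
  ext u
  exact LinearMap.congr_fun hlin u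

variable [CompleteSpace F] [FiniteDimensional F V]

theorem RegularTriple.isClosed_orbit
    (h : RegularTriple F n X.toLinearMap v (vs.toLinearMap : Module.Dual F V)) :
    IsClosed {x | ∃ g : V ≃L[F] V, x = tripleConj g (X, v, vs)} := by
  have hset : {x | ∃ g : V ≃L[F] V, x = tripleConj g (X, v, vs)} =
      ⋂ i : ℕ, {x : (V →L[F] V) × V × (V →L[F] F) |
        x.2.2 ((x.1 ^ i) x.2.1) = vs ((X ^ i) v)} := by
    ext ⟨Y, w, ws⟩
    simp only [Set.mem_iInter, Set.mem_ofPred_eq]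
    constructor
    · rintro ⟨g, hg⟩ i
      have := tripleConj_invariant g (X, v, vs) i
      rwa [← hg] at this
    · intro hinv
      obtain ⟨g, hgX, hgv, hgs⟩ := h.exists_linearEquiv (Y := Y.toLinearMap) (w := w)
        (ws := ws.toLinearMap) fun i => by
          rw [← ContinuousLinearMap.toLinearMap_pow, ← ContinuousLinearMap.toLinearMap_pow]
          exact hinv i
      refine ⟨g.toContinuousLinearEquiv, Prod.ext ?_ (Prod.ext hgv.symm ?_)⟩
      · ext u
        have := hgX (g.symm u)
        rw [g.apply_symm_apply] at this
        exact this.symm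
      · ext u
        have := hgs (g.symm u)
        rw [g.apply_symm_apply] at this
        exact this
  rw [hset]
  exact isClosed_iInter fun i => isClosed_eq (by fun_prop) continuous_const

theorem regularTriple_of_isClosed_orbit [CharZero F]
    (hclosed : IsClosed {x | ∃ g : V ≃L[F] V, x = tripleConj g (X, v, vs)})
    (hstab : ∀ g : V ≃L[F] V, tripleConj g (X, v, vs) = (X, v, vs) →
      g = ContinuousLinearEquiv.refl F V) :
    RegularTriple F (Module.finrank F V) X.toLinearMap v
      (vs.toLinearMap : Module.Dual F V) := by
  refine regularTriple_of_span_eq_top_of_ker_eq_bot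
    (eq_top_of_isClosed_orbit hclosed hstab (fun u hu => ?_) (Submodule.subset_span ⟨0, rfl⟩))
    (eq_bot_of_isClosed_orbit hclosed hstab (fun u hu => ?_) fun u hu => ?_)
  · induction hu using Submodule.span_induction with
    | mem x hx =>
      obtain ⟨i, rfl⟩ := hx
      refine Submodule.subset_span ⟨i + 1, ?_⟩
      simp [pow_succ']
    | zero => simp
    | add x y _ _ hx hy => simpa using Submodule.add_mem _ hx hy
    | smul a x _ hx => simpa using Submodule.smul_mem _ a hx
  · rw [LinearMap.mem_ker] at hu ⊢
    ext i
    exact (observation_map X.toLinearMap vs.toLinearMap u i).trans (congrFun hu (i + 1))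
  · exact congrFun (LinearMap.mem_ker.mp hu) 0

end Regular

/-- Over a non-archimedean local field `F` of characteristic `0`, a triple `(X, v, v*)`
is regular if and only if its `GL(V)`-orbit is closed in `End(V) × V × V*` and its
stabilizer in `GL(V)` is trivial. -/
theorem statement2 {F : Type*} [NontriviallyNormedField F] [CompleteSpace F]
    [LocallyCompactSpace F] [TotallyDisconnectedSpace F] [CharZero F]
    {V : Type*} [NormedAddCommGroup V] [NormedSpace F V] [FiniteDimensional F V]
    {n : ℕ} (hn : 1 ≤ n) (hdim : Module.finrank F V = n)
    (X : V →L[F] V) (v : V) (vs : V →L[F] F) :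
    RegularTriple F n X.toLinearMap v (vs.toLinearMap : Module.Dual F V) ↔
      (IsClosed {p : (V →L[F] V) × V × (V →L[F] F) |
          ∃ g : V ≃L[F] V,
            p = ((g : V →L[F] V).comp (X.comp (g.symm : V →L[F] V)), g v,
              vs.comp (g.symm : V →L[F] V))} ∧
        ∀ g : V ≃L[F] V,
          (g : V →L[F] V).comp (X.comp (g.symm : V →L[F] V)) = X → g v = v →
            vs.comp (g.symm : V →L[F] V) = vs → g = ContinuousLinearEquiv.refl F V) := by
  subst hdim
  constructor
  · exact fun h => ⟨h.isClosed_orbit, fun g hX hv hvs =>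
      h.eq_refl_of_tripleConj_eq (Prod.ext hX (Prod.ext hv hvs))⟩
  · rintro ⟨hclosed, hstab⟩
    refine regularTriple_of_isClosed_orbit hclosed fun g hg => ?_
    simp only [tripleConj, Prod.ext_iff] at hg
    exact hstab g hg.1 hg.2.1 hg.2.2
end

section
/- Let (X, v, v*) ∈ End(V) × V × V*. Let E be the subspace of V spanned by {X^j v : j ∈ ℕ}, let E' be the subspace of V* spanned by {v*∘X^j : j ∈ ℕ}, and let E^⊥ ⊆ V* be the annihilator of E. Since X(E) ⊆ E, X induces an endomorphism C of V/E. Then the GL(V)-orbit of (X, v, v*) is closed in End(V) × V × V* if and only if V* is the internal direct sum of E' and E^⊥ and the induced endomorphism C of V/E is semisimple (i.e. every C-invariant subspace of V/E has a C-invariant complement). -/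
open Polynomial Topology Filter

section Algebra

variable {F R : Type*} [Field F] [Ring R] [Algebra F R]

/-- If conjugating `X` by a unit `g` gives its block-diagonal part with respect to an idempotent
`ρ` whose range is `X`-stable, then the `X`-stable range of `ρ` has an `X`-stable complement,
given as the range of an idempotent `f` commuting with `X`. -/
theorem exists_commuting_complement_of_conj_blockDiagonal [FiniteDimensional F R]
    {X ρ g g' : R} (hρ : ρ * ρ = ρ) (hXρ : ρ * X * ρ = X * ρ) (hg : g * g' = 1)
    (hg' : g' * g = 1)
    (hconj : g * X = (ρ * X * ρ + (1 - ρ) * X * (1 - ρ)) * g) :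
    ∃ f : R, (1 - ρ) * f = 1 - ρ ∧ f * ρ = 0 ∧ X * f = f * X := by
  set X₀ := ρ * X * ρ + (1 - ρ) * X * (1 - ρ) with hX₀
  set σ := 1 - ρ with hσ
  have hσσ : σ * σ = σ := by
    have : (1 - ρ) * (1 - ρ) = 1 - ρ - ρ + ρ * ρ := by noncomm_ring
    rw [hσ, this, hρ, sub_add_cancel]
  have hσρ : σ * ρ = 0 := by rw [hσ, sub_mul, one_mul, hρ, sub_self]
  have hρσ : ρ * σ = 0 := by rw [hσ, mul_sub, mul_one, hρ, sub_self]
  have hσXρ : σ * X * ρ = 0 := by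
    rw [hσ, sub_mul, sub_mul, one_mul, hXρ, sub_self]
  have hσX : σ * X * σ = σ * X := by
    have : σ * X * σ = σ * X - σ * X * ρ := by rw [hσ]; noncomm_ring
    rw [this, hσXρ, sub_zero]
  have hX₀σ : X₀ * σ = σ * X := by
    rw [hX₀, add_mul, mul_assoc _ ρ σ, hρσ, mul_zero, zero_add, mul_assoc _ σ σ, hσσ, hσX]
  have hX₀ρ : X₀ * ρ = X * ρ := by
    rw [hX₀, add_mul, mul_assoc _ ρ ρ, hρ, mul_assoc _ σ ρ, hσρ, mul_zero, add_zero, hXρ]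
  let H : R → Submodule F R := fun N =>
    { carrier := {f | f * ρ = 0 ∧ N * f = f * X}
      add_mem' := by
        rintro a b ⟨h1, h2⟩ ⟨h3, h4⟩
        exact ⟨by rw [add_mul, h1, h3, add_zero], by rw [mul_add, add_mul, h2, h4]⟩
      zero_mem' := by simp
      smul_mem' := by
        rintro c x ⟨h1, h2⟩
        exact ⟨by rw [smul_mul_assoc, h1, smul_zero], by
          rw [smul_mul_assoc, mul_smul_comm, h2]⟩ }
  have memH : ∀ N f, f ∈ H N ↔ f * ρ = 0 ∧ N * f = f * X := fun _ _ => Iff.rfl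
  let e : H X ≃ₗ[F] H X₀ :=
    { toFun := fun f => ⟨g * f.1, by rw [mul_assoc, f.2.1, mul_zero], by
        rw [← mul_assoc, ← hconj, mul_assoc, f.2.2, mul_assoc]⟩
      invFun := fun f => ⟨g' * f.1, by rw [mul_assoc, f.2.1, mul_zero], by
        have h1 : X * g' = g' * X₀ := by
          calc X * g' = g' * g * X * g' := by rw [hg', one_mul]
            _ = g' * (g * X) * g' := by noncomm_ring
            _ = g' * X₀ * (g * g') := by rw [hconj]; noncomm_ring
            _ = g' * X₀ := by rw [hg, mul_one]
        rw [← mul_assoc, h1, mul_assoc, f.2.2, mul_assoc]⟩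
      map_add' := fun a b => Subtype.ext (mul_add _ _ _)
      map_smul' := fun c a => Subtype.ext (mul_smul_comm _ _ _)
      left_inv := fun f => Subtype.ext (by simp [← mul_assoc, hg'])
      right_inv := fun f => Subtype.ext (by simp [← mul_assoc, hg]) }
  let S : R →ₗ[F] R := LinearMap.mulLeft F σ
  have hker : H X ⊓ LinearMap.ker S = H X₀ ⊓ LinearMap.ker S := by
    ext f
    simp only [Submodule.mem_inf, memH, LinearMap.mem_ker, S, LinearMap.mulLeft_apply]
    refine and_congr_left fun hf => and_congr_right fun _ => ?_
    have : f = ρ * f := by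
      have h : f = ρ * f + σ * f := by rw [hσ]; noncomm_ring
      rwa [hf, add_zero] at h
    rw [this, ← mul_assoc, ← mul_assoc, hX₀ρ]
  have hfin : ∀ N, Module.finrank F ((H N).map S) + Module.finrank F ↥(H N ⊓ LinearMap.ker S)
      = Module.finrank F (H N) := by
    intro N
    have h := LinearMap.finrank_range_add_finrank_ker (S.domRestrict (H N))
    rw [LinearMap.range_domRestrict, LinearMap.ker_domRestrict] at h
    rw [← h, ← (Submodule.comapSubtypeEquivOfLe (inf_le_left :
      H N ⊓ LinearMap.ker S ≤ H N)).finrank_eq]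
    have hk : (H N ⊓ LinearMap.ker S).comap (H N).subtype
        = (LinearMap.ker S).comap (H N).subtype := by
      ext x; simp
    rw [hk]
  have hle : (H X).map S ≤ (H X₀).map S := by
    rintro _ ⟨f, hf, rfl⟩
    refine ⟨σ * f, ⟨by rw [mul_assoc, hf.1, mul_zero], ?_⟩, ?_⟩
    · rw [← mul_assoc, hX₀σ, mul_assoc, hf.2, mul_assoc]
    · simp only [S, LinearMap.mulLeft_apply]
      rw [← mul_assoc, hσσ]
  have heq : (H X).map S = (H X₀).map S := by
    refine Submodule.eq_of_le_of_finrank_eq hle ?_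
    have h1 := hfin X
    have h2 := hfin X₀
    have h3 := e.finrank_eq
    rw [hker] at h1
    omega
  have hmem : σ ∈ (H X).map S := by
    rw [heq]
    exact ⟨σ, ⟨hσρ, hX₀σ⟩, hσσ⟩
  obtain ⟨f, hf, hfσ⟩ := hmem
  exact ⟨f, hfσ, hf.1, hf.2⟩

theorem commute_aeval_left {x y : R} (hxy : Commute x y) (p : F[X]) : Commute (aeval x p) y := by
  induction p using Polynomial.induction_on' with
  | add p q hp hq => rw [map_add]; exact hp.add_left hq
  | monomial k a =>
    rw [aeval_monomial]
    exact (Algebra.commute_algebraMap_left a y).mul_left (hxy.pow_left k)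

/-- A noncommutative difference quotient of a polynomial `m`. -/
theorem exists_continuous_differenceQuotient [TopologicalSpace R] [IsTopologicalRing R]
    [ContinuousConstSMul F R] (m : F[X]) :
    ∃ D : R → R → R, Continuous (Function.uncurry D) ∧
      (∀ z y, z * D z y - D z y * y = aeval z m - aeval y m) ∧
      ∀ y, D y y = aeval y (derivative m) := by
  have hpow : ∀ k : ℕ, ∃ D : R → R → R, Continuous (Function.uncurry D) ∧
      (∀ z y, z * D z y - D z y * y = z ^ k - y ^ k) ∧
      ∀ y, D y y = aeval y (derivative (X ^ k : F[X])) := by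
    intro k
    induction k with
    | zero => exact ⟨fun _ _ => 0, by fun_prop, by simp, by simp⟩
    | succ k ih =>
      obtain ⟨D, hD, h1, h2⟩ := ih
      refine ⟨fun z y => z * D z y + y ^ k, ?_, fun z y => ?_, fun y => ?_⟩
      · exact (continuous_fst.mul hD).add (continuous_snd.pow k)
      · have : z * (z * D z y + y ^ k) - (z * D z y + y ^ k) * y
            = z * (z * D z y - D z y * y) + z * y ^ k - y ^ k * y := by noncomm_ring
        rw [this, h1, pow_succ' z, pow_succ y]
        noncomm_ring
      · change y * D y y + y ^ k = _
        rw [h2, pow_succ', derivative_mul, derivative_X, one_mul]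
        simp [add_comm]
  induction m using Polynomial.induction_on' with
  | add p q hp hq =>
    obtain ⟨D, hD, h1, h2⟩ := hp
    obtain ⟨D', hD', h1', h2'⟩ := hq
    refine ⟨fun z y => D z y + D' z y, hD.add hD', fun z y => ?_, fun y => ?_⟩
    · rw [map_add, map_add, mul_add, add_mul, add_sub_add_comm, h1, h1', add_sub_add_comm]
    · change D y y + D' y y = _
      rw [h2, h2', derivative_add, map_add]
  | monomial k a =>
    obtain ⟨D, hD, h1, h2⟩ := hpow k
    refine ⟨fun z y => a • D z y, hD.const_smul a, fun z y => ?_, fun y => ?_⟩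
    · rw [mul_smul_comm, smul_mul_assoc, ← smul_sub, h1, ← C_mul_X_pow_eq_monomial, smul_sub]
      simp [Algebra.smul_def]
    · change a • D y y = _
      rw [h2, ← C_mul_X_pow_eq_monomial, derivative_C_mul, map_mul, aeval_C, Algebra.smul_def]

theorem smul_idempotent_mul_mul_smul_idempotent {X ρ : R} (hX : ρ * X * ρ = X * ρ) {a b : F}
    (ha : a ≠ 0) (hb : b ≠ 0) :
    (a • (1 - ρ) + b • ρ) * (X * (a⁻¹ • (1 - ρ) + b⁻¹ • ρ)) =
      ρ * X * ρ + (1 - ρ) * X * (1 - ρ) + (b * a⁻¹) • (ρ * X * (1 - ρ)) := by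
  set σ := 1 - ρ with hσ
  have hσXρ : σ * (X * ρ) = 0 := by
    rw [hσ, sub_mul, one_mul, ← mul_assoc, hX, sub_self]
  simp only [add_mul, mul_add, smul_mul_assoc, mul_smul_comm, smul_smul, hσXρ, smul_zero,
    inv_mul_cancel₀ ha, inv_mul_cancel₀ hb, one_smul, mul_assoc, mul_comm b, zero_add, smul_add]
  abel

/-- The combination `∑ c (i, j) Z ^ i T Y ^ j`. -/
noncomputable def sandwich (c : ℕ × ℕ →₀ F) (Z T Y : R) : R :=
  c.sum fun ij a => a • (Z ^ ij.1 * T * Y ^ ij.2)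

theorem map_sandwich {R' : Type*} [Ring R'] [Algebra F R'] (f : R →ₐ[F] R')
    (c : ℕ × ℕ →₀ F) (Z T Y : R) :
    f (sandwich c Z T Y) = sandwich c (f Z) (f T) (f Y) := by
  simp [sandwich, Finsupp.sum, map_sum]

end Algebra

section Orbit

variable {F : Type*} [NontriviallyNormedField F] {V : Type*} [NormedAddCommGroup V]
  [NormedSpace F V]

theorem smulRight_mul_mul_smulRight (s s' : V →L[F] F) (w w' : V) (B : V →L[F] V) :
    s.smulRight w * B * s'.smulRight w' = s (B w') • s'.smulRight w := by
  ext x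
  simp [smul_smul, mul_comm]

theorem sandwich_smulRight_mul_mul_sandwich_smulRight (c : ℕ × ℕ →₀ F) (A Y B : V →L[F] V)
    (s s' : V →L[F] F) (w w' : V) :
    sandwich c A (s.smulRight w) Y * Y * sandwich c Y (s'.smulRight w') B =
      c.sum fun ij a => c.sum fun kl b =>
        (a * b * s ((Y ^ (ij.2 + 1 + kl.1)) w')) • (A ^ ij.1 * s'.smulRight w * B ^ kl.2) := by
  simp only [sandwich, Finsupp.sum, Finset.sum_mul]
  refine Finset.sum_congr rfl fun ij _ => ?_
  rw [Finset.mul_sum]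
  refine Finset.sum_congr rfl fun kl _ => ?_
  have h : A ^ ij.1 * s.smulRight w * Y ^ ij.2 * Y * (Y ^ kl.1 * s'.smulRight w' * B ^ kl.2)
      = A ^ ij.1 * (s.smulRight w * Y ^ (ij.2 + 1 + kl.1) * s'.smulRight w') * B ^ kl.2 := by
    rw [pow_add, pow_succ]
    simp only [mul_assoc]
  rw [smul_mul_assoc, smul_mul_assoc, mul_smul_comm, h, smulRight_mul_mul_smulRight,
    mul_smul_comm, smul_mul_assoc, smul_smul, smul_smul]

theorem sandwich_smulRight_apply (c : ℕ × ℕ →₀ F) (Z Y : V →L[F] V) (s : V →L[F] F) (w x : V) :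
    sandwich c Z (s.smulRight w) Y x = c.sum fun ij a => (a * s ((Y ^ ij.2) x)) • (Z ^ ij.1) w := by
  simp [sandwich, Finsupp.sum, smul_smul]

theorem apply_sandwich_smulRight_apply (c : ℕ × ℕ →₀ F) (Z Y : V →L[F] V) (r s : V →L[F] F)
    (w x : V) :
    r (sandwich c Z (s.smulRight w) Y x) =
      c.sum fun ij a => a * s ((Y ^ ij.2) x) * r ((Z ^ ij.1) w) := by
  simp [sandwich_smulRight_apply, Finsupp.sum]

variable (F V) in
/-- The space of triples `(X, v, v*)`. -/
abbrev Triple : Type _ := (V →L[F] V) × V × (V →L[F] F)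

/-- The operator `∑ c (i, j) (X ^ i v) ⊗ (v* ∘ X ^ j)`. -/
noncomputable def Triple.proj (c : ℕ × ℕ →₀ F) (q : Triple F V) : V →L[F] V :=
  sandwich c q.1 (q.2.2.smulRight q.2.1) q.1

/-- The triples with given moments `v* (X ^ k v)` on which `Triple.proj c` is an `X`-stable
projection fixing `v` and `v*`, and on whose kernel `X` is killed by the polynomial `m`. -/
def Triple.stratum (c : ℕ × ℕ →₀ F) (m : F[X]) (h : ℕ → F) : Set (Triple F V) :=
  {q | (∀ k, q.2.2 ((q.1 ^ k) q.2.1) = h k) ∧ q.proj c q.2.1 = q.2.1 ∧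
    q.2.2.comp (q.proj c) = q.2.2 ∧ q.1 * q.proj c = q.proj c * q.1 ∧
    aeval q.1 m * (1 - q.proj c) = 0 ∧ q.proj c * q.proj c = q.proj c}

theorem continuous_sandwich {Z : Type*} [TopologicalSpace Z] (c : ℕ × ℕ →₀ F)
    {A T B : Z → V →L[F] V} (hA : Continuous A) (hT : Continuous T) (hB : Continuous B) :
    Continuous fun z => sandwich c (A z) (T z) (B z) := by
  unfold sandwich Finsupp.sum
  fun_prop

theorem continuous_smulRight {Z : Type*} [TopologicalSpace Z] {s : Z → V →L[F] F} {w : Z → V}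
    (hs : Continuous s) (hw : Continuous w) : Continuous fun z => (s z).smulRight (w z) :=
  ((ContinuousLinearMap.smulRightL F V V).continuous.comp hs).clm_apply hw

theorem Triple.continuous_proj (c : ℕ × ℕ →₀ F) :
    Continuous (Triple.proj c : Triple F V → V →L[F] V) :=
  continuous_sandwich c continuous_fst
    (continuous_smulRight (continuous_snd.comp continuous_snd) (continuous_fst.comp continuous_snd))
    continuous_fst

theorem Triple.isClosed_stratum (c : ℕ × ℕ →₀ F) (m : F[X]) (h : ℕ → F) :
    IsClosed (Triple.stratum c m h : Set (Triple F V)) := by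
  have hp := Triple.continuous_proj (F := F) (V := V) c
  have hm : Continuous fun q : Triple F V => aeval q.1 m := by
    simp only [aeval_eq_sum_range]
    fun_prop
  have h1 : ∀ k, Continuous fun q : Triple F V => q.2.2 ((q.1 ^ k) q.2.1) := fun k =>
    (by fun_prop : Continuous fun q : Triple F V => q.2.2).clm_apply
      ((by fun_prop : Continuous fun q : Triple F V => q.1 ^ k).clm_apply (by fun_prop))
  have hv : Continuous fun q : Triple F V => q.2.1 := by fun_prop
  have hs : Continuous fun q : Triple F V => q.2.2 := by fun_prop
  have hX : Continuous fun q : Triple F V => q.1 := by fun_prop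
  simp only [Triple.stratum, Set.ofPred_and, Set.ofPred_forall]
  refine (isClosed_iInter fun k => isClosed_eq (h1 k) continuous_const).inter
    ((isClosed_eq (hp.clm_apply hv) hv).inter ((isClosed_eq (hs.clm_comp hp) hs).inter
    ((isClosed_eq (hX.mul hp) (hp.mul hX)).inter
    ((isClosed_eq (hm.mul (continuous_const.sub hp)) continuous_const).inter
    (isClosed_eq (hp.mul hp) hp)))))

/-- The action of `GL(V)` on triples. -/
def Triple.act (g : V ≃L[F] V) (q : Triple F V) : Triple F V :=
  ((g : V →L[F] V).comp (q.1.comp (g.symm : V →L[F] V)), g q.2.1,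
    q.2.2.comp (g.symm : V →L[F] V))

theorem Triple.act_mem_stratum {c : ℕ × ℕ →₀ F} {m : F[X]} {h : ℕ → F} (g : V ≃L[F] V)
    {q : Triple F V} (hq : q ∈ Triple.stratum c m h) : q.act g ∈ Triple.stratum c m h := by
  let κ : (V →L[F] V) →ₐ[F] (V →L[F] V) := g.conjContinuousAlgEquiv
  have hκ : ∀ A, κ A = (g : V →L[F] V).comp (A.comp (g.symm : V →L[F] V)) := fun A => rfl
  have hκ' : ∀ A x, κ A (g x) = g (A x) := fun A x => by simp [hκ]
  have h1 : (q.act g).1 = κ q.1 := rfl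
  have hπ : (q.act g).proj c = κ (q.proj c) := by
    rw [Triple.proj, Triple.proj, map_sandwich]
    congr 1
    ext x
    simp [Triple.act, hκ]
  obtain ⟨a1, a2, a3, a4, a5, a6⟩ := hq
  refine ⟨fun k => ?_, ?_, ?_, ?_, ?_, ?_⟩
  · rw [h1, ← map_pow, ← a1 k]
    simp [Triple.act, hκ]
  · rw [hπ]
    exact (hκ' _ _).trans (congrArg g a2)
  · rw [hπ]
    ext x
    have := DFunLike.congr_fun a3 (g.symm x)
    simpa [Triple.act, hκ] using this
  · rw [hπ, h1, ← map_mul, a4, map_mul]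
  · rw [hπ, h1, aeval_algHom_apply, ← map_one κ, ← map_sub, ← map_mul, a5, map_zero]
  · rw [hπ, ← map_mul, a6]

/-- Nearby triples in a stratum with separable polynomial are conjugate. -/
theorem Triple.eventually_exists_act_eq [CompleteSpace V] {c : ℕ × ℕ →₀ F} {m : F[X]}
    (hm : m.Separable) {h : ℕ → F} {q : Triple F V} (hq : q ∈ Triple.stratum c m h) :
    ∀ᶠ z in 𝓝 q, z ∈ Triple.stratum c m h → ∃ g : V ≃L[F] V, z = q.act g := by
  obtain ⟨D, hD, hD1, hD2⟩ :=
    exists_continuous_differenceQuotient (F := F) (R := V →L[F] V) m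
  obtain ⟨a, u, hau⟩ := hm
  obtain ⟨Y, w, s⟩ := q
  set πY := Triple.proj c (Y, w, s) with hπY
  obtain ⟨b1, b2, b3, b4, b5, b6⟩ := hq
  simp only [← hπY] at b1 b2 b3 b4 b5 b6
  let P : Triple F V → (V →L[F] V) := fun z => sandwich c z.1 (s.smulRight z.2.1) Y
  let φ : Triple F V → (V →L[F] V) := fun z =>
    P z + (1 - z.proj c) * D z.1 Y * aeval Y u * (1 - πY)
  have hφ : Continuous φ := by
    have hP : Continuous P := continuous_sandwich c continuous_fst
      (continuous_smulRight continuous_const (by fun_prop)) continuous_const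
    have hp := Triple.continuous_proj (F := F) (V := V) c
    have hDc : Continuous fun z : Triple F V => D z.1 Y :=
      hD.comp (continuous_fst.prodMk continuous_const)
    exact hP.add ((((continuous_const.sub hp).mul hDc).mul continuous_const).mul continuous_const)
  have hφq : φ (Y, w, s) = 1 := by
    have hP : P (Y, w, s) = πY := rfl
    have hu : aeval Y (derivative m) * aeval Y u * (1 - πY) = 1 - πY := by
      have h1 := congrArg (fun p => aeval Y p * (1 - πY)) hau
      simp only [map_add, map_mul, map_one, add_mul, one_mul] at h1
      rw [mul_assoc, b5, mul_zero, zero_add] at h1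
      rw [← map_mul, mul_comm, map_mul, h1]
    change P (Y, w, s) + (1 - πY) * D Y Y * aeval Y u * (1 - πY) = 1
    rw [hP, hD2, mul_assoc, mul_assoc, ← mul_assoc (aeval Y _) (aeval Y u), hu]
    have : πY + (1 - πY) * (1 - πY) = 1 - πY + πY * πY := by noncomm_ring
    rw [this, b6, sub_add_cancel]
  have hunit : ∀ᶠ z in 𝓝 (Y, w, s), IsUnit (φ z) :=
    hφ.continuousAt.eventually (Units.isOpen.mem_nhds (by
      change IsUnit (φ (Y, w, s)); rw [hφq]; exact isUnit_one))
  filter_upwards [hunit] with z hz hzs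
  obtain ⟨Z, wz, sz⟩ := z
  set πZ := Triple.proj c (Z, wz, sz) with hπZ
  obtain ⟨d1, d2, d3, d4, d5, d6⟩ := hzs
  simp only [← hπZ] at d1 d2 d3 d4 d5 d6
  set Pz := P (Z, wz, sz)
  set G := (1 - πZ) * D Z Y * aeval Y u * (1 - πY) with hG
  have hφz : φ (Z, wz, sz) = Pz + G := rfl
  have hPπ : Pz * πY = Pz ∧ πZ * Pz = Pz := by
    constructor
    · ext x
      have h2 : ∀ j, s ((Y ^ j) (πY x)) = s ((Y ^ j) x) := fun j => by
        have hc : Y ^ j * πY = πY * Y ^ j := ((show Commute Y πY from b4).pow_left j).eq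
        have h3 := DFunLike.congr_fun hc x
        have h4 := DFunLike.congr_fun b3 ((Y ^ j) x)
        simp only [mul_apply_eq_comp] at h3
        rw [h3]; exact h4
      change sandwich c Z (s.smulRight wz) Y (πY x) = sandwich c Z (s.smulRight wz) Y x
      simp only [sandwich_smulRight_apply, h2]
    · ext x
      have h2 : ∀ i, πZ ((Z ^ i) wz) = (Z ^ i) wz := fun i => by
        have hc : Z ^ i * πZ = πZ * Z ^ i := ((show Commute Z πZ from d4).pow_left i).eq
        have h3 := DFunLike.congr_fun hc wz
        simp only [mul_apply_eq_comp] at h3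
        rw [← h3, d2]
      change πZ (sandwich c Z (s.smulRight wz) Y x) = sandwich c Z (s.smulRight wz) Y x
      simp only [sandwich_smulRight_apply, Finsupp.sum, map_sum, map_smul, h2]
  have hPcomm : Z * Pz = Pz * Y := by
    have hex : Pz * Y * πY = πZ * Z * Pz := by
      change sandwich c Z (s.smulRight wz) Y * Y * sandwich c Y (s.smulRight w) Y =
        sandwich c Z (sz.smulRight wz) Z * Z * sandwich c Z (s.smulRight wz) Y
      rw [sandwich_smulRight_mul_mul_sandwich_smulRight,
        sandwich_smulRight_mul_mul_sandwich_smulRight]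
      simp only [b1, d1]
    rw [mul_assoc, b4, ← mul_assoc, hPπ.1, ← d4, mul_assoc, hPπ.2] at hex
    exact hex.symm
  have hGcomm : Z * G = G * Y := by
    have hcY : (1 - πY) * Y = Y * (1 - πY) := by rw [sub_mul, mul_sub, b4, one_mul, mul_one]
    have hcZ : Z * (1 - πZ) = (1 - πZ) * Z := by rw [sub_mul, mul_sub, d4, one_mul, mul_one]
    have hcu : aeval Y u * Y = Y * aeval Y u := 
      (commute_aeval_left (Commute.refl Y) u).eq
    have hcm : aeval Y m * aeval Y u = aeval Y u * aeval Y m := by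
      rw [← map_mul, mul_comm, map_mul]
    have hcm' : (1 - πZ) * aeval Z m = 0 := by
      rw [← (commute_aeval_left hcZ m).eq, d5]
    have hk : Z * G - G * Y = (1 - πZ) * (Z * D Z Y - D Z Y * Y) * aeval Y u * (1 - πY) := by
      have e1 : Z * G = (1 - πZ) * (Z * D Z Y) * aeval Y u * (1 - πY) := by
        rw [hG]; simp only [← mul_assoc]; rw [hcZ]
      have e2 : G * Y = (1 - πZ) * (D Z Y * Y) * aeval Y u * (1 - πY) := by
        rw [hG]; simp only [mul_assoc]; rw [hcY, ← mul_assoc (aeval Y u) Y, hcu]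
        simp only [mul_assoc]
      rw [e1, e2]; noncomm_ring
    rw [← sub_eq_zero, hk, hD1, mul_sub (1 - πZ), hcm', zero_sub, neg_mul, neg_mul, mul_assoc (1 - πZ),
      hcm, mul_assoc, mul_assoc, b5, mul_zero, mul_zero, neg_zero]
  have hPw : Pz w = wz := by
    conv_rhs => rw [← d2]
    change sandwich c Z (s.smulRight wz) Y w = sandwich c Z (sz.smulRight wz) Z wz
    simp only [sandwich_smulRight_apply, b1, d1]
  have hsP : sz.comp Pz = s := by
    conv_rhs => rw [← b3]
    ext x
    change sz (sandwich c Z (s.smulRight wz) Y x) = s (sandwich c Y (s.smulRight w) Y x)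
    simp only [apply_sandwich_smulRight_apply, b1, d1]
  have hGw : G w = 0 := by
    have : (1 - πY) w = 0 := by simp [b2]
    rw [hG, mul_apply_eq_comp, this, map_zero]
  have hsG : sz.comp G = 0 := by
    have : sz.comp (1 - πZ) = 0 := by
      ext x
      have := DFunLike.congr_fun d3 x
      simp only [ContinuousLinearMap.comp_apply] at this
      simp [this]
    ext x
    exact DFunLike.congr_fun this _
  obtain ⟨U, hU⟩ := hz
  rw [hφz] at hU
  let g : V ≃L[F] V := ContinuousLinearEquiv.unitsEquiv F V U
  have hg : ∀ x, g x = (Pz + G) x := fun x => by rw [← hU]; rfl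
  refine ⟨g, Prod.ext ?_ (Prod.ext ?_ ?_)⟩
  · ext x
    have h0 : Z * (Pz + G) = (Pz + G) * Y := by rw [mul_add, add_mul, hPcomm, hGcomm]
    have h1 := DFunLike.congr_fun h0 (g.symm x)
    simp only [mul_apply_eq_comp, ← hg] at h1
    simpa [Triple.act] using h1
  · change wz = g w
    rw [hg, add_apply, hPw, hGw, add_zero]
  · ext x
    have h1 : sz (g (g.symm x)) = s (g.symm x) := by
      rw [hg]
      have h2 := DFunLike.congr_fun hsP (g.symm x)
      have h3 := DFunLike.congr_fun hsG (g.symm x)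
      simp only [ContinuousLinearMap.comp_apply, zero_apply] at h2 h3
      rw [add_apply, map_add, h2, h3, add_zero]
    simpa [Triple.act] using h1

theorem Triple.isClosed_orbit_of_mem_stratum [CompleteSpace V] {c : ℕ × ℕ →₀ F} {m : F[X]}
    (hm : m.Separable) {h : ℕ → F} {q : Triple F V} (hq : q ∈ Triple.stratum c m h) :
    IsClosed {p | ∃ g : V ≃L[F] V, p = q.act g} := by
  refine isClosed_of_closure_subset fun y hy => ?_
  have hsub : {p | ∃ g : V ≃L[F] V, p = q.act g} ⊆ Triple.stratum c m h := by
    rintro _ ⟨g, rfl⟩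
    exact Triple.act_mem_stratum g hq
  have hys := (Triple.isClosed_stratum c m h).closure_subset_iff.2 hsub hy
  obtain ⟨z, ⟨g, rfl⟩, hz⟩ := ((mem_closure_iff_frequently.1 hy).and_eventually
    (Triple.eventually_exists_act_eq hm hys)).exists
  obtain ⟨k, hk⟩ := hz (Triple.act_mem_stratum g hq)
  refine ⟨g.trans k.symm, ?_⟩
  have hy : y = (y.act k).act k.symm := by
    refine Prod.ext ?_ (Prod.ext ?_ ?_)
    · ext; simp [Triple.act]
    · simp [Triple.act]
    · ext; simp [Triple.act]
  rw [hy, ← hk]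
  rfl

theorem Triple.exists_act_eq_scale {q : Triple F V} {ρ : V →L[F] V} (hρ : ρ * ρ = ρ)
    (hX : ρ * q.1 * ρ = q.1 * ρ) {a b : F} (ha : a ≠ 0) (hb : b ≠ 0) :
    ∃ g : V ≃L[F] V, ((ρ * q.1 * ρ + (1 - ρ) * q.1 * (1 - ρ) + (b * a⁻¹) • (ρ * q.1 * (1 - ρ)),
      a • (1 - ρ) q.2.1 + b • ρ q.2.1,
      a⁻¹ • q.2.2.comp (1 - ρ) + b⁻¹ • q.2.2.comp ρ) : Triple F V) = q.act g := by
  obtain ⟨X, v, s⟩ := q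
  dsimp only at hX ⊢
  set σ := 1 - ρ with hσ
  have hσσ : σ * σ = σ := by
    have : (1 - ρ) * (1 - ρ) = 1 - ρ - ρ + ρ * ρ := by noncomm_ring
    rw [hσ, this, hρ, sub_add_cancel]
  have hσρ : σ * ρ = 0 := by rw [hσ, sub_mul, one_mul, hρ, sub_self]
  have hρσ : ρ * σ = 0 := by rw [hσ, mul_sub, mul_one, hρ, sub_self]
  have hadd : σ + ρ = 1 := sub_add_cancel _ _
  have hinv : ∀ c d c' d' : F, c * c' = 1 → d * d' = 1 →
      (c • σ + d • ρ) * (c' • σ + d' • ρ) = 1 := by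
    intro c d c' d' h1 h2
    simp only [add_mul, mul_add, smul_mul_assoc, mul_smul_comm, smul_smul, hσσ, hσρ, hρσ, hρ,
      mul_comm c', mul_comm d', h1, h2, smul_zero, add_zero, zero_add, one_smul, hadd]
  have h1 := hinv a⁻¹ b⁻¹ a b (inv_mul_cancel₀ ha) (inv_mul_cancel₀ hb)
  have h2 := hinv a b a⁻¹ b⁻¹ (mul_inv_cancel₀ ha) (mul_inv_cancel₀ hb)
  let g : V ≃L[F] V := ContinuousLinearEquiv.equivOfInverse (a • σ + b • ρ) (a⁻¹ • σ + b⁻¹ • ρ)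
    (fun x => DFunLike.congr_fun h1 x) (fun x => DFunLike.congr_fun h2 x)
  refine ⟨g, Prod.ext ?_ (Prod.ext ?_ ?_)⟩
  · change _ = (a • σ + b • ρ) * (X * (a⁻¹ • σ + b⁻¹ • ρ))
    rw [smul_idempotent_mul_mul_smul_idempotent hX ha hb]
  · rfl
  · change _ = s.comp (a⁻¹ • σ + b⁻¹ • ρ)
    ext x
    simp

theorem mem_of_isClosed_of_continuous_of_ne_zero {Z : Type*} [TopologicalSpace Z] {S : Set Z}
    (hS : IsClosed S) {p : F → Z} (hp : Continuous p) (h : ∀ t, t ≠ 0 → p t ∈ S) : p 0 ∈ S :=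
  hS.mem_of_tendsto (hp.continuousAt.tendsto.mono_left nhdsWithin_le_nhds : Tendsto p (𝓝[≠] 0) _)
    (eventually_mem_nhdsWithin.mono h)

theorem Triple.exists_act_eq_of_apply_eq_zero {q : Triple F V}
    (hq : IsClosed {p | ∃ g : V ≃L[F] V, p = q.act g}) {ρ : V →L[F] V} (hρ : ρ * ρ = ρ)
    (hX : ρ * q.1 * ρ = q.1 * ρ) (hs : q.2.2.comp ρ = 0) :
    ∃ g : V ≃L[F] V, ((ρ * q.1 * ρ + (1 - ρ) * q.1 * (1 - ρ), (1 - ρ) q.2.1, q.2.2) : Triple F V)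
      = q.act g := by
  have h := mem_of_isClosed_of_continuous_of_ne_zero hq
    (p := fun t : F => ((ρ * q.1 * ρ + (1 - ρ) * q.1 * (1 - ρ) + t • (ρ * q.1 * (1 - ρ)),
      (1 - ρ) q.2.1 + t • ρ q.2.1, q.2.2) : Triple F V)) (by fun_prop) fun t ht => by
      obtain ⟨g, hg⟩ := Triple.exists_act_eq_scale hρ hX one_ne_zero ht
      refine ⟨g, hg ▸ ?_⟩
      have : q.2.2.comp (1 - ρ) = q.2.2 := by
        ext x
        have := DFunLike.congr_fun hs x
        simp only [ContinuousLinearMap.comp_apply, zero_apply] at this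
        simp [this]
      have h0 : (1 : F)⁻¹ • q.2.2.comp (1 - ρ) + t⁻¹ • q.2.2.comp ρ = q.2.2 := by
        rw [this, hs]
        ext x
        simp
      rw [h0, inv_one, mul_one, one_smul]
  simpa using h

theorem Triple.exists_act_eq_of_apply_eq_self {q : Triple F V}
    (hq : IsClosed {p | ∃ g : V ≃L[F] V, p = q.act g}) {ρ : V →L[F] V} (hρ : ρ * ρ = ρ)
    (hX : ρ * q.1 * ρ = q.1 * ρ) (hv : ρ q.2.1 = q.2.1) :
    ∃ g : V ≃L[F] V, ((ρ * q.1 * ρ + (1 - ρ) * q.1 * (1 - ρ), q.2.1, q.2.2.comp ρ) : Triple F V)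
      = q.act g := by
  have h := mem_of_isClosed_of_continuous_of_ne_zero hq
    (p := fun t : F => ((ρ * q.1 * ρ + (1 - ρ) * q.1 * (1 - ρ) + t • (ρ * q.1 * (1 - ρ)),
      q.2.1, t • q.2.2.comp (1 - ρ) + q.2.2.comp ρ) : Triple F V)) (by fun_prop) fun t ht => by
      obtain ⟨g, hg⟩ := Triple.exists_act_eq_scale hρ hX (inv_ne_zero ht) one_ne_zero
      refine ⟨g, hg ▸ ?_⟩
      simp [hv]
  have h0 : (0 : F) • q.2.2.comp (1 - ρ) + q.2.2.comp ρ = q.2.2.comp ρ := by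
    ext x
    simp
  rwa [h0, zero_smul, add_zero] at h

theorem semiconjBy_of_eq_act {X X₀ : V →L[F] V} {v v₀ : V} {vs vs₀ : V →L[F] F} {g : V ≃L[F] V}
    (h : ((X₀, v₀, vs₀) : Triple F V) = Triple.act g (X, v, vs)) :
    SemiconjBy (g : V →L[F] V) X X₀ := by
  have h1 : X₀ = (g : V →L[F] V).comp (X.comp (g.symm : V →L[F] V)) := congrArg Prod.fst h
  ext x
  simp [h1]

theorem idempotent_relations {A : Submodule F V} {X ρ : V →L[F] V} (h1 : ∀ x, ρ x ∈ A)
    (h2 : ∀ x ∈ A, ρ x = x) (hA : ∀ x ∈ A, X x ∈ A) : ρ * ρ = ρ ∧ ρ * X * ρ = X * ρ :=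
  ⟨by ext x; exact h2 _ (h1 x), by ext x; exact h2 _ (hA _ (h1 x))⟩

variable {X : V →L[F] V} {v : V} {vs : V →L[F] F} {E : Submodule F V}
  {E' : Submodule F (Module.Dual F V)}

theorem apply_mem_span_pow (hE : E = Submodule.span F (Set.range fun j : ℕ => (X ^ j) v)) :
    v ∈ E ∧ ∀ x ∈ E, X x ∈ E := by
  subst hE
  refine ⟨Submodule.subset_span ⟨0, by simp⟩, fun x hx => ?_⟩
  induction hx using Submodule.span_induction with
  | mem x hx =>
    obtain ⟨i, rfl⟩ := hx
    exact Submodule.subset_span ⟨i + 1, by simp [pow_succ']⟩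
  | zero => simp
  | add x y _ _ hx hy => rw [map_add]; exact add_mem hx hy
  | smul a x _ hx => rw [map_smul]; exact Submodule.smul_mem _ _ hx

theorem comp_mem_span_comp_pow (hE' : E' = Submodule.span F
      (Set.range fun j : ℕ => ((vs.comp (X ^ j)).toLinearMap : Module.Dual F V))) :
    vs.toLinearMap ∈ E' ∧ ∀ f ∈ E', f ∘ₗ X.toLinearMap ∈ E' := by
  subst hE'
  refine ⟨Submodule.subset_span ⟨0, by ext; simp⟩, fun x hx => ?_⟩
  induction hx using Submodule.span_induction with
  | mem x hx =>
    obtain ⟨i, rfl⟩ := hx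
    exact Submodule.subset_span ⟨i + 1, by ext; simp [pow_succ]⟩
  | zero => simp
  | add x y _ _ hx hy => rw [LinearMap.add_comp]; exact add_mem hx hy
  | smul a x _ hx => rw [LinearMap.smul_comp]; exact Submodule.smul_mem _ _ hx

end Orbit

section FiniteDimensional

variable {F : Type*} [NontriviallyNormedField F] [CompleteSpace F] {V : Type*}
  [NormedAddCommGroup V] [NormedSpace F V] [FiniteDimensional F V]

theorem exists_continuous_idempotent (A : Submodule F V) :
    ∃ ρ : V →L[F] V, (∀ x, ρ x ∈ A) ∧ ∀ x ∈ A, ρ x = x := by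
  obtain ⟨l, hl⟩ := A.subtype.exists_leftInverse_of_injective A.ker_subtype
  refine ⟨(A.subtype ∘ₗ l).toContinuousLinearMap, fun x => (l x).2, fun x hx => ?_⟩
  exact congrArg Subtype.val (DFunLike.congr_fun hl ⟨x, hx⟩)

theorem mem_span_sandwich (X : V →L[F] V) (v : V) (vs : V →L[F] F) {e : V}
    (he : e ∈ Submodule.span F (Set.range fun j : ℕ => (X ^ j) v)) {f : Module.Dual F V}
    (hf : f ∈ Submodule.span F
      (Set.range fun j : ℕ => ((vs.comp (X ^ j)).toLinearMap : Module.Dual F V))) :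
    f.toContinuousLinearMap.smulRight e ∈ Submodule.span F
      (Set.range fun ij : ℕ × ℕ => X ^ ij.1 * vs.smulRight v * X ^ ij.2) := by
  induction he using Submodule.span_induction with
  | mem x hx =>
    obtain ⟨i, rfl⟩ := hx
    induction hf using Submodule.span_induction with
    | mem f hf =>
      obtain ⟨j, rfl⟩ := hf
      exact Submodule.subset_span ⟨(i, j), by ext x; exact map_smul (X ^ i) (vs ((X ^ j) x)) v⟩
    | zero => convert Submodule.zero_mem _; ext x; simp
    | add f g _ _ hf hg => convert Submodule.add_mem _ hf hg using 1; ext x; simp [add_smul]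
    | smul a f _ hf => convert Submodule.smul_mem _ a hf using 1; ext x; simp [smul_smul]
  | zero => convert Submodule.zero_mem _; ext x; simp
  | add x y _ _ hx hy => convert Submodule.add_mem _ hx hy using 1; ext x; simp
  | smul a x _ hx =>
    convert Submodule.smul_mem _ a hx using 1
    ext x
    simp [smul_smul, mul_comm]

variable {X : V →L[F] V} {v : V} {vs : V →L[F] F} {E : Submodule F V}
  {E' : Submodule F (Module.Dual F V)}

theorem Triple.exists_mem_stratum
    (hE : E = Submodule.span F (Set.range fun j : ℕ => (X ^ j) v))
    (hE' : E' = Submodule.span F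
      (Set.range fun j : ℕ => ((vs.comp (X ^ j)).toLinearMap : Module.Dual F V)))
    (hc : IsCompl E' E.dualAnnihilator) {m : F[X]} (hm : ∀ x, aeval X m x ∈ E) :
    ∃ c h, ((X, v, vs) : Triple F V) ∈ Triple.stratum c m h := by
  obtain ⟨hv, hEX⟩ := apply_mem_span_pow hE
  obtain ⟨hvs, hEX'⟩ := comp_mem_span_comp_pow hE'
  let b := Module.finBasis F E
  have hf : ∀ a, ∃ f ∈ E', ∀ x : E, f x = b.coord a x := by
    intro a
    obtain ⟨g, hg⟩ := LinearMap.exists_extend (b.coord a)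
    obtain ⟨f, hf, f', hf', hff⟩ := Submodule.mem_sup.1
      (hc.sup_eq_top ▸ Submodule.mem_top : g ∈ E' ⊔ E.dualAnnihilator)
    refine ⟨f, hf, fun x => ?_⟩
    rw [Submodule.mem_dualAnnihilator] at hf'
    rw [← hg, ← hff]
    simp [hf' x x.2]
  choose f hf' hfb using hf
  have hmem : ∑ a, (f a).toContinuousLinearMap.smulRight (b a : V) ∈ Submodule.span F
      (Set.range fun ij : ℕ × ℕ => X ^ ij.1 * vs.smulRight v * X ^ ij.2) := by
    refine Submodule.sum_mem _ fun a _ => mem_span_sandwich X v vs ?_ ?_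
    · rw [← hE]; exact (b a).2
    · rw [← hE']; exact hf' a
  obtain ⟨c, hcπ⟩ := Finsupp.mem_span_range_iff_exists_finsupp.1 hmem
  set π : V →L[F] V := ∑ a, (f a).toContinuousLinearMap.smulRight (b a : V) with hπ
  have hproj : Triple.proj c ((X, v, vs) : Triple F V) = π := hcπ
  have hπx : ∀ x, π x = ∑ a, f a x • (b a : V) := fun x => by simp [hπ]
  have hπE : ∀ x, π x ∈ E := fun x => by
    rw [hπx]
    exact Submodule.sum_mem _ fun a _ => Submodule.smul_mem _ _ (b a).2
  have hπe : ∀ x ∈ E, π x = x := fun x hx => by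
    rw [hπx]
    have := congrArg Subtype.val (b.sum_repr ⟨x, hx⟩)
    rw [← Submodule.subtype_apply, map_sum] at this
    simp only [map_smul, Submodule.subtype_apply] at this
    rw [← this]
    refine Finset.sum_congr rfl fun a _ => ?_
    have h3 := hfb a ⟨x, hx⟩
    simp only [Module.Basis.coord_apply] at h3
    rw [← h3, this]
  have hfπ : ∀ φ ∈ E', ∀ x, φ (π x) = φ x := by
    intro φ hφ
    have h1 : φ ∘ₗ π.toLinearMap - φ ∈ E' ⊓ E.dualAnnihilator := by
      refine ⟨sub_mem ?_ hφ, ?_⟩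
      · have : φ ∘ₗ π.toLinearMap = ∑ a, φ (b a) • f a := by
          ext x
          simp [hπx, mul_comm]
        rw [this]
        exact Submodule.sum_mem _ fun a _ => Submodule.smul_mem _ _ (hf' a)
      · rw [SetLike.mem_coe, Submodule.mem_dualAnnihilator]
        intro x hx
        simp [hπe x hx]
    rw [hc.inf_eq_bot, Submodule.mem_bot, sub_eq_zero] at h1
    exact fun x => DFunLike.congr_fun h1 x
  have hzero : ∀ x ∈ E, (∀ φ ∈ E', φ x = 0) → x = 0 := fun x hx h => by
    rw [← hπe x hx, hπx]
    exact Finset.sum_eq_zero fun a _ => by rw [h _ (hf' a), zero_smul]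
  have hcomm : X * π = π * X := by
    ext x
    simp only [mul_apply_eq_comp]
    rw [← sub_eq_zero]
    refine hzero _ (sub_mem (hEX _ (hπE _)) (hπE _)) fun φ hφ => ?_
    rw [map_sub, hfπ φ hφ, sub_eq_zero]
    exact hfπ _ (hEX' φ hφ) x
  have hππ : π * π = π := by ext x; exact hπe _ (hπE x)
  refine ⟨c, fun k => vs ((X ^ k) v), fun k => rfl, ?_⟩
  rw [hproj]
  refine ⟨hπe v hv, ?_, hcomm, ?_, hππ⟩
  · ext x; exact hfπ _ hvs x
  · have h1 : π * (aeval X m * (1 - π)) = aeval X m * (1 - π) := by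
      ext x; exact hπe _ (hm _)
    rw [← h1, ← mul_assoc, ← (commute_aeval_left hcomm m).eq, mul_assoc, mul_sub, mul_one, hππ,
      sub_self, mul_zero]

end FiniteDimensional

section ClosedOrbit

variable {F : Type*} [NontriviallyNormedField F] [CompleteSpace F] {V : Type*}
  [NormedAddCommGroup V] [NormedSpace F V] [FiniteDimensional F V]
  {X : V →L[F] V} {v : V} {vs : V →L[F] F} {E : Submodule F V}
  {E' : Submodule F (Module.Dual F V)}

theorem disjoint_dualAnnihilator_of_isClosed_orbit
    (hE : E = Submodule.span F (Set.range fun j : ℕ => (X ^ j) v))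
    (hE' : E' = Submodule.span F
      (Set.range fun j : ℕ => ((vs.comp (X ^ j)).toLinearMap : Module.Dual F V)))
    (hcl : IsClosed {p | ∃ g : V ≃L[F] V, p = Triple.act g (X, v, vs)}) :
    E' ⊓ E.dualAnnihilator = ⊥ := by
  obtain ⟨hv, hEX⟩ := apply_mem_span_pow hE
  obtain ⟨ρ, h1, h2⟩ := exists_continuous_idempotent E
  obtain ⟨hρ, hX⟩ := idempotent_relations h1 h2 hEX
  obtain ⟨g, hg⟩ := Triple.exists_act_eq_of_apply_eq_self hcl hρ hX (h2 v hv)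
  dsimp only at hg
  have hgX := semiconjBy_of_eq_act hg
  have hρX : SemiconjBy ρ (ρ * X * ρ + (1 - ρ) * X * (1 - ρ)) X := by
    have h3 : ρ * (1 - ρ) = 0 := by rw [mul_sub, mul_one, hρ, sub_self]
    rw [SemiconjBy, mul_add, mul_assoc (1 - ρ), ← mul_assoc ρ (1 - ρ), h3, zero_mul, add_zero,
      mul_assoc ρ, ← mul_assoc ρ ρ, hρ, ← mul_assoc, hX]
  have hs : ∀ x, vs (ρ (g x)) = vs x := fun x => by
    have h3 : vs.comp ρ = vs.comp (g.symm : V →L[F] V) := congrArg (fun p => p.2.2) hg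
    simpa using DFunLike.congr_fun h3 (g x)
  have key : ∀ f ∈ E', ∀ x, f (ρ (g x)) = f x := by
    intro f hf
    rw [hE'] at hf
    induction hf using Submodule.span_induction with
    | mem f hf =>
      obtain ⟨j, rfl⟩ := hf
      intro x
      have h3 := DFunLike.congr_fun ((hρX.mul_left hgX).pow_right j).eq x
      change ρ (g ((X ^ j) x)) = (X ^ j) (ρ (g x)) at h3
      change vs ((X ^ j) (ρ (g x))) = vs ((X ^ j) x)
      rw [← h3, hs]
    | zero => simp
    | add f f' _ _ hf hf' => intro x; simp [hf, hf']
    | smul a f _ hf => intro x; simp [hf]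
  rw [eq_bot_iff]
  rintro f ⟨hf, hf'⟩
  rw [SetLike.mem_coe, Submodule.mem_dualAnnihilator] at hf'
  ext x
  rw [← key f hf x]
  exact hf' _ (h1 _)

/-- If the orbit is closed, an `X`-stable subspace killed by `v*` meets `E` trivially and has an
`X`-stable complement. -/
theorem disjoint_and_exists_complement_of_isClosed_orbit
    (hE : E = Submodule.span F (Set.range fun j : ℕ => (X ^ j) v))
    (hcl : IsClosed {p | ∃ g : V ≃L[F] V, p = Triple.act g (X, v, vs)})
    {A : Submodule F V} (hA : ∀ x ∈ A, X x ∈ A) (hvs : ∀ x ∈ A, vs x = 0) :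
    E ⊓ A = ⊥ ∧ ∃ Q : Submodule F V, (∀ x ∈ Q, X x ∈ Q) ∧ IsCompl A Q := by
  obtain ⟨ρ, h1, h2⟩ := exists_continuous_idempotent A
  obtain ⟨hρ, hX⟩ := idempotent_relations h1 h2 hA
  obtain ⟨g, hg⟩ := Triple.exists_act_eq_of_apply_eq_zero hcl hρ hX
    (by ext x; exact hvs _ (h1 x))
  dsimp only at hg
  have hgX := semiconjBy_of_eq_act hg
  constructor
  · have hσX : SemiconjBy (1 - ρ) X (ρ * X * ρ + (1 - ρ) * X * (1 - ρ)) := by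
      have h3 : ρ * (1 - ρ) = 0 := by rw [mul_sub, mul_one, hρ, sub_self]
      have h4 : (1 - ρ) * (1 - ρ) = 1 - ρ := by rw [sub_mul, one_mul, h3, sub_zero]
      have h5 : (1 - ρ) * X * ρ = 0 := by rw [sub_mul, sub_mul, one_mul, hX, sub_self]
      rw [SemiconjBy, add_mul, mul_assoc _ ρ, h3, mul_zero, zero_add, mul_assoc _ (1 - ρ), h4,
        mul_sub, h5, mul_one, sub_zero]
    have hv : (1 - ρ) v = g v := congrArg (fun p => p.2.1) hg
    have key : ∀ x ∈ E, (1 - ρ) x = g x := by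
      intro x hx
      rw [hE] at hx
      induction hx using Submodule.span_induction with
      | mem x hx =>
        obtain ⟨j, rfl⟩ := hx
        have h3 := DFunLike.congr_fun (hσX.pow_right j).eq v
        have h4 := DFunLike.congr_fun (hgX.pow_right j).eq v
        simp only [mul_apply_eq_comp] at h3 h4
        rw [hv] at h3
        exact h3.trans h4.symm
      | zero => simp
      | add x y _ _ hx hy => rw [map_add, map_add, hx, hy]
      | smul a x _ hx => rw [map_smul, map_smul, hx]
    rw [eq_bot_iff]
    rintro x ⟨hx, hxA⟩
    have h3 := key x hx
    have h4 : (1 - ρ) x = 0 := by simp [h2 x hxA]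
    rw [h4] at h3
    exact g.map_eq_zero_iff.1 h3.symm
  · obtain ⟨f, hf1, hf2, hf3⟩ := exists_commuting_complement_of_conj_blockDiagonal (F := F)
      (g := (g : V →L[F] V)) (g' := (g.symm : V →L[F] V)) hρ hX (by ext x; simp) (by ext x; simp)
      hgX.eq
    have hmem : ∀ x, (1 - ρ) x = 0 → x ∈ A ∧ ρ x = x := fun x hx => by
      have h3 : ρ x = x := (sub_eq_zero.1 hx).symm
      exact ⟨h3 ▸ h1 x, h3⟩
    refine ⟨LinearMap.range f.toLinearMap, ?_, ?_, ?_⟩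
    · rintro _ ⟨y, rfl⟩
      exact ⟨X y, (DFunLike.congr_fun hf3 y).symm⟩
    · rw [Submodule.disjoint_def]
      rintro _ hx ⟨y, rfl⟩
      have h3 : (1 - ρ) (f y) = 0 := by simpa [sub_eq_zero] using (h2 _ hx).symm
      have h4 := (hmem y ((DFunLike.congr_fun hf1 y).symm.trans h3)).2
      rw [← h4]
      exact DFunLike.congr_fun hf2 y
    · rw [codisjoint_iff, eq_top_iff]
      intro x _
      refine Submodule.mem_sup.2 ⟨x - f x, (hmem _ ?_).1, f x, ⟨x, rfl⟩, sub_add_cancel _ _⟩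
      rw [map_sub, sub_eq_zero]
      exact (DFunLike.congr_fun hf1 x).symm

end ClosedOrbit

/-- Over a non-archimedean local field `F` of characteristic `0`, the `GL(V)`-orbit of
`(X, v, v*)` is closed in `End(V) × V × V*` if and only if `V*` is the internal direct sum
of `E' = span {v*∘X^j}` and the annihilator `E^⊥` of `E = span {X^j v}`, and the
endomorphism `C` of `V/E` induced by `X` is semisimple (every `C`-invariant subspace of
`V/E` has a `C`-invariant complement). -/
theorem statement3 {F : Type*} [NontriviallyNormedField F] [CompleteSpace F]
    [LocallyCompactSpace F] [TotallyDisconnectedSpace F] [CharZero F]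
    {V : Type*} [NormedAddCommGroup V] [NormedSpace F V] [FiniteDimensional F V]
    {n : ℕ} (hn : 1 ≤ n) (hdim : Module.finrank F V = n)
    (X : V →L[F] V) (v : V) (vs : V →L[F] F)
    (E : Submodule F V) (hE : E = Submodule.span F (Set.range fun j : ℕ => (X ^ j) v))
    (E' : Submodule F (Module.Dual F V))
    (hE' : E' = Submodule.span F
      (Set.range fun j : ℕ => ((vs.comp (X ^ j)).toLinearMap : Module.Dual F V)))
    (C : (V ⧸ E) →ₗ[F] (V ⧸ E)) (hC : C ∘ₗ E.mkQ = E.mkQ ∘ₗ X.toLinearMap) :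
    IsClosed {p : (V →L[F] V) × V × (V →L[F] F) |
        ∃ g : V ≃L[F] V,
          p = ((g : V →L[F] V).comp (X.comp (g.symm : V →L[F] V)), g v,
            vs.comp (g.symm : V →L[F] V))} ↔
      (IsCompl E' E.dualAnnihilator ∧
        ∀ p : Submodule F (V ⧸ E), (∀ x ∈ p, C x ∈ p) →
          ∃ q : Submodule F (V ⧸ E), (∀ x ∈ q, C x ∈ q) ∧ IsCompl p q) := by
  have hset : {p : (V →L[F] V) × V × (V →L[F] F) | ∃ g : V ≃L[F] V,
      p = ((g : V →L[F] V).comp (X.comp (g.symm : V →L[F] V)), g v,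
        vs.comp (g.symm : V →L[F] V))} = {p | ∃ g : V ≃L[F] V, p = Triple.act g (X, v, vs)} := rfl
  rw [hset]
  obtain ⟨hvs, hEX'⟩ := comp_mem_span_comp_pow hE'
  have hCX : ∀ x, C (E.mkQ x) = E.mkQ (X x) := fun x => DFunLike.congr_fun hC x
  constructor
  · intro hcl
    set W := E'.dualCoannihilator with hW
    have hWX : ∀ x ∈ W, X x ∈ W := fun x hx => by
      rw [hW, Submodule.mem_dualCoannihilator] at hx ⊢
      exact fun φ hφ => hx _ (hEX' φ hφ)
    have hWvs : ∀ x ∈ W, vs x = 0 := fun x hx =>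
      (Submodule.mem_dualCoannihilator x).1 hx _ hvs
    have hdis := disjoint_dualAnnihilator_of_isClosed_orbit hE hE' hcl
    have hEW := (disjoint_and_exists_complement_of_isClosed_orbit hE hcl hWX hWvs).1
    have hWE' : W.dualAnnihilator = E' := Subspace.dualCoannihilator_dualAnnihilator_eq
    refine ⟨⟨disjoint_iff.2 hdis, codisjoint_iff.2 ?_⟩, fun p hp => ?_⟩
    · rw [← Subspace.dualCoannihilator_dualAnnihilator_eq (W := E' ⊔ E.dualAnnihilator),
        Submodule.dualCoannihilator_sup_eq, Subspace.dualAnnihilator_dualCoannihilator_eq,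
        inf_comm, ← hW, hEW, Submodule.dualAnnihilator_bot]
    · have htop : E ⊔ W = ⊤ := by
        rw [← Subspace.dualAnnihilator_inj, Submodule.dualAnnihilator_sup_eq, hWE', inf_comm, hdis,
          Submodule.dualAnnihilator_top]
      obtain ⟨-, Q, hQX, hQ⟩ := disjoint_and_exists_complement_of_isClosed_orbit hE hcl
        (A := W ⊓ p.comap E.mkQ)
        (fun x hx => ⟨hWX x hx.1, by
          rw [SetLike.mem_coe, Submodule.mem_comap, ← hCX]; exact hp _ hx.2⟩)
        (fun x hx => hWvs x hx.1)
      refine ⟨(W ⊓ Q).map E.mkQ, ?_, ?_, ?_⟩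
      · rintro _ ⟨x, hx, rfl⟩
        rw [hCX]
        exact ⟨X x, ⟨hWX x hx.1, hQX x hx.2⟩, rfl⟩
      · rw [Submodule.disjoint_def]
        rintro _ hy ⟨x, hx, rfl⟩
        rw [Submodule.disjoint_def.1 hQ.disjoint x ⟨hx.1, hy⟩ hx.2, map_zero]
      · rw [codisjoint_iff, eq_top_iff]
        intro y _
        obtain ⟨x, rfl⟩ := E.mkQ_surjective y
        obtain ⟨e, he, w, hw, rfl⟩ := Submodule.mem_sup.1
          (htop ▸ Submodule.mem_top : x ∈ E ⊔ W)
        obtain ⟨a, ha, b, hb, rfl⟩ := Submodule.mem_sup.1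
          (hQ.sup_eq_top ▸ Submodule.mem_top : w ∈ (W ⊓ p.comap E.mkQ) ⊔ Q)
        have hbW : b ∈ W := by simpa using sub_mem hw ha.1
        have he0 : E.mkQ e = 0 := by simpa using he
        rw [map_add, he0, zero_add, map_add]
        exact Submodule.add_mem_sup ha.2 ⟨b, ⟨hbW, hb⟩, rfl⟩
  · rintro ⟨hc, hss⟩
    have hCss : Module.End.IsSemisimple C := Module.End.isSemisimple_iff.2 fun p hp => by
      obtain ⟨q, hq, hpq⟩ := hss p hp
      exact ⟨q, hq, hpq⟩
    have hsep : (minpoly F C).Separable :=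
      PerfectField.separable_iff_squarefree.2 hCss.minpoly_squarefree
    have hm : ∀ x, aeval X (minpoly F C) x ∈ E := fun x => by
      have hpoly : ∀ (m : F[X]) (x : V), E.mkQ (aeval X m x) = aeval C m (E.mkQ x) := by
        intro m
        induction m using Polynomial.induction_on with
        | C a => intro x; simp [Algebra.algebraMap_eq_smul_one]
        | add p q hp hq => intro x; simp only [map_add, add_apply, LinearMap.add_apply, hp, hq]
        | monomial n a ih =>
          intro x
          simp only [pow_succ, ← mul_assoc, map_mul (aeval X) _ Polynomial.X,
            map_mul (aeval C) _ Polynomial.X, aeval_X, mul_apply_eq_comp, Module.End.mul_apply,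
            hCX, ih]
      have h0 := hpoly (minpoly F C) x
      rw [minpoly.aeval, LinearMap.zero_apply] at h0
      simpa using h0
    obtain ⟨c, h, hmem⟩ := Triple.exists_mem_stratum hE hE' hc hm
    have : CompleteSpace V := FiniteDimensional.complete F V
    exact Triple.isClosed_orbit_of_mem_stratum hsep hmem
end

section
/- For 1 ≤ r ≤ n let A_r(X, v, v*) be the r×r matrix with (i,j) entry q_{i+j−2}(X, v, v*) (1 ≤ i, j ≤ r), let E_r be the span of (v, Xv, …, X^{r−1}v) and E'_r the span of (v*, v*∘X, …, v*∘X^{r−1}). Then: (a) for each r, A_r(X, v, v*) is invertible if and only if dim E_r = r, dim E'_r = r, and the pairing (φ, u) ↦ φ(u) restricted to E'_r × E_r is nondegenerate; (b) the following are equivalent: A_r(X, v, v*) is singular for every r ∈ {1, …, n}; q_j(X, v, v*) = 0 for j = 0, …, n−1; q_j(X, v, v*) = 0 for every j ∈ ℕ; every element of E'_n vanishes identically on E_n. -/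
/-- `E_r(X, v)`: the span of `(v, Xv, …, X^{r−1}v)`. -/
def spanE (F : Type*) {V : Type*} [Field F] [AddCommGroup V] [Module F V]
    (r : ℕ) (X : V →ₗ[F] V) (v : V) : Submodule F V :=
  Submodule.span F (Set.range fun i : Fin r => (X ^ (i : ℕ)) v)

/-- `E'_r(X, v*)`: the span of `(v*, v*∘X, …, v*∘X^{r−1})` in the dual space. -/
def spanE' (F : Type*) {V : Type*} [Field F] [AddCommGroup V] [Module F V]
    (r : ℕ) (X : V →ₗ[F] V) (vs : Module.Dual F V) : Submodule F (Module.Dual F V) :=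
  Submodule.span F (Set.range fun i : Fin r => (vs ∘ₗ X ^ (i : ℕ) : Module.Dual F V))

/-- A family indexed by `Fin r` is linearly independent iff its span has dimension `r`. -/
theorem linearIndependent_iff_finrank_span_eq {F W : Type*} [Field F] [AddCommGroup W]
    [Module F W] {r : ℕ} (b : Fin r → W) :
    LinearIndependent F b ↔ Module.finrank F (Submodule.span F (Set.range b)) = r := by
  rw [linearIndependent_iff_card_eq_finrank_span, Fintype.card_fin, eq_comm, Set.finrank]

/-- The Gram matrix of two families is invertible iff both families are linearly independent and
the pairing between their spans is nondegenerate. -/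
theorem isUnit_gram_iff {F V : Type*} [Field F] [AddCommGroup V] [Module F V] {r : ℕ}
    (φ : Fin r → Module.Dual F V) (w : Fin r → V) :
    IsUnit (Matrix.of fun i j : Fin r => φ i (w j)) ↔
      (Module.finrank F (Submodule.span F (Set.range w)) = r ∧
        Module.finrank F (Submodule.span F (Set.range φ)) = r ∧
        (∀ ψ ∈ Submodule.span F (Set.range φ),
          (∀ u ∈ Submodule.span F (Set.range w), ψ u = 0) → ψ = 0) ∧
        (∀ u ∈ Submodule.span F (Set.range w),
          (∀ ψ ∈ Submodule.span F (Set.range φ), ψ u = 0) → u = 0)) := by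
  have hmul (c : Fin r → F) (i : Fin r) :
      ((Matrix.of fun i j : Fin r => φ i (w j)).mulVec c) i = φ i (∑ j, c j • w j) := by
    simp [Matrix.mulVec, dotProduct, mul_comm]
  have hvec (c : Fin r → F) (j : Fin r) :
      (Matrix.vecMul c (Matrix.of fun i j : Fin r => φ i (w j))) j = (∑ i, c i • φ i) (w j) := by
    simp [Matrix.vecMul, dotProduct]
  constructor
  · intro h
    have hm := Matrix.mulVec_injective_iff_isUnit.2 h
    have hv := Matrix.vecMul_injective_iff_isUnit.2 h
    have hm0 (c : Fin r → F) (hc : ∀ i, φ i (∑ j, c j • w j) = 0) : c = 0 :=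
      hm (by ext i; simp [hmul, hc])
    have hv0 (c : Fin r → F) (hc : ∀ j, (∑ i, c i • φ i) (w j) = 0) : c = 0 :=
      hv (funext fun j => by simp only [hvec, hc]; simp)
    refine ⟨?_, ?_, ?_, ?_⟩
    · rw [← linearIndependent_iff_finrank_span_eq, Fintype.linearIndependent_iff]
      exact fun c hc => congrFun (hm0 c fun i => by rw [hc, map_zero])
    · rw [← linearIndependent_iff_finrank_span_eq, Fintype.linearIndependent_iff]
      exact fun c hc => congrFun (hv0 c fun j => by rw [hc, LinearMap.zero_apply])
    · intro ψ hψ h0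
      obtain ⟨c, rfl⟩ := (Submodule.mem_span_range_iff_exists_fun F).1 hψ
      simp [hv0 c fun j => h0 _ (Submodule.subset_span ⟨j, rfl⟩)]
    · intro u hu h0
      obtain ⟨c, rfl⟩ := (Submodule.mem_span_range_iff_exists_fun F).1 hu
      simp [hm0 c fun i => h0 _ (Submodule.subset_span ⟨i, rfl⟩)]
  · rintro ⟨hw, -, -, hnd⟩
    rw [← linearIndependent_iff_finrank_span_eq, Fintype.linearIndependent_iff] at hw
    rw [← Matrix.mulVec_injective_iff_isUnit, ← Matrix.coe_mulVecLin,
      injective_iff_map_eq_zero]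
    intro c hc
    refine funext (hw c (hnd _ ((Submodule.mem_span_range_iff_exists_fun F).2 ⟨c, rfl⟩) ?_))
    intro ψ hψ
    induction hψ using Submodule.span_induction with
    | mem ψ h =>
      obtain ⟨i, rfl⟩ := h
      rw [← hmul, ← Matrix.mulVecLin_apply, hc, Pi.zero_apply]
    | zero => rfl
    | add ψ χ _ _ h₁ h₂ => rw [LinearMap.add_apply, h₁, h₂, add_zero]
    | smul a ψ _ h => rw [LinearMap.smul_apply, h, smul_zero]

/-- A Hankel matrix vanishing strictly above the antidiagonal, with nonzero antidiagonal entries,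
is invertible. -/
theorem isUnit_hankel_of_eq_zero {F : Type*} [Field F] (q : ℕ → F) (m : ℕ)
    (h0 : ∀ j < m, q j = 0) (hm : q m ≠ 0) :
    IsUnit (Matrix.of fun i j : Fin (m + 1) => q ((i : ℕ) + (j : ℕ))) := by
  rw [← Matrix.isUnit_submatrix_equiv (Equiv.refl _) Fin.revPerm, Matrix.isUnit_iff_isUnit_det,
    Matrix.det_of_isLowerTriangular]
  · refine IsUnit.mk0 _ (Finset.prod_ne_zero_iff.2 fun i _ => ?_)
    have : (i : ℕ) + (m - i) = m := by omega
    simpa [Fin.val_rev, this] using hm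
  · intro i j hij
    have hij' : (i : ℕ) < j := hij
    exact h0 _ (by simp [Fin.val_rev]; omega)

/-- If a functional vanishes on the first `finrank F V` iterates of `v`, it vanishes on all. -/
theorem dual_pow_apply_eq_zero {F V : Type*} [Field F] [AddCommGroup V] [Module F V]
    [FiniteDimensional F V] (X : V →ₗ[F] V) (v : V) (vs : Module.Dual F V)
    (h : ∀ j < Module.finrank F V, vs ((X ^ j) v) = 0) (k : ℕ) : vs ((X ^ k) v) = 0 := by
  rcases Nat.eq_zero_or_pos (Module.finrank F V) with hV | hV
  · have := Module.finrank_zero_iff.1 hV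
    rw [Subsingleton.elim ((X ^ k) v) 0, map_zero]
  have hdeg : (Polynomial.X ^ k %ₘ X.charpoly).natDegree < Module.finrank F V := by
    rw [← X.charpoly_natDegree] at hV ⊢
    exact Polynomial.natDegree_modByMonic_lt _ X.charpoly_monic fun h1 => by simp [h1] at hV
  rw [LinearMap.pow_eq_aeval_mod_charpoly, Polynomial.aeval_eq_sum_range' hdeg]
  simp only [LinearMap.sum_apply, LinearMap.smul_apply, map_sum, map_smul]
  exact Finset.sum_eq_zero fun j hj => by rw [h j (Finset.mem_range.1 hj), smul_zero]

/-- (a) For each `1 ≤ r ≤ n`, the `r×r` matrix `A_r(X, v, v*)` with entries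
`q_{i+j-2} = v*(X^{i+j-2}v)` is invertible iff `dim E_r = r`, `dim E'_r = r` and the
natural pairing restricted to `E'_r × E_r` is nondegenerate.
(b) The following are equivalent: `A_r` is singular for every `1 ≤ r ≤ n`;
`q_j = 0` for `j = 0, …, n−1`; `q_j = 0` for all `j ∈ ℕ`; every element of `E'_n`
vanishes identically on `E_n`. -/
theorem statement6 {F V : Type*} [Field F] [AddCommGroup V] [Module F V]
    [FiniteDimensional F V] {n : ℕ} (hn : 1 ≤ n) (hdim : Module.finrank F V = n)
    (X : V →ₗ[F] V) (v : V) (vs : Module.Dual F V) :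
    (∀ r : ℕ, 1 ≤ r → r ≤ n →
      (IsUnit (Matrix.of fun i j : Fin r => vs ((X ^ ((i : ℕ) + (j : ℕ))) v)) ↔
        (Module.finrank F (spanE F r X v) = r ∧
          Module.finrank F (spanE' F r X vs) = r ∧
          (∀ φ ∈ spanE' F r X vs, (∀ u ∈ spanE F r X v, φ u = 0) → φ = 0) ∧
          (∀ u ∈ spanE F r X v, (∀ φ ∈ spanE' F r X vs, φ u = 0) → u = 0)))) ∧
    [∀ r : ℕ, 1 ≤ r → r ≤ n →
        ¬ IsUnit (Matrix.of fun i j : Fin r => vs ((X ^ ((i : ℕ) + (j : ℕ))) v)),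
      ∀ j < n, vs ((X ^ j) v) = 0,
      ∀ j : ℕ, vs ((X ^ j) v) = 0,
      ∀ φ ∈ spanE' F n X vs, ∀ u ∈ spanE F n X v, φ u = 0].TFAE := by
  subst hdim
  refine ⟨fun r _ _ => ?_, ?_⟩
  · simp only [pow_add, Module.End.mul_apply]
    exact isUnit_gram_iff (fun i : Fin r => (vs ∘ₗ X ^ (i : ℕ) : Module.Dual F V))
        (fun i : Fin r => (X ^ (i : ℕ)) v)
  tfae_have 1 → 2 := by
    intro h j
    induction j using Nat.strong_induction_on with
    | _ j ih =>
      intro hj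
      by_contra hne
      exact h (j + 1) (by omega) hj (isUnit_hankel_of_eq_zero (fun k => vs ((X ^ k) v)) j
        (fun k hk => ih k hk (hk.trans hj)) hne)
  tfae_have 2 → 3 := dual_pow_apply_eq_zero X v vs
  tfae_have 3 → 1 := by
    intro h r hr _ hu
    have : Nonempty (Fin r) := ⟨⟨0, hr⟩⟩
    refine hu.ne_zero ?_
    ext i j
    exact h _
  tfae_have 3 → 4 := by
    intro h φ hφ u hu
    obtain ⟨c, rfl⟩ := (Submodule.mem_span_range_iff_exists_fun F).1 hφ
    obtain ⟨d, rfl⟩ := (Submodule.mem_span_range_iff_exists_fun F).1 hu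
    simp [← Module.End.mul_apply, ← pow_add, h]
  tfae_have 4 → 2 := by
    intro h j hj
    exact h vs (Submodule.subset_span ⟨⟨0, hn⟩, LinearMap.ext fun _ => by simp⟩) _
      (Submodule.subset_span ⟨⟨j, hj⟩, rfl⟩)
  tfae_finish
end

section
/- Let c be an F-linear endomorphism of V = V₁ × W^r commuting with X. Define α ∈ End(V₁) by α(v₁) = the V₁-component of c(v₁, 0, …, 0), and d₁ ∈ End(W) by d₁(w) = the r-th W-component of c(0, 0, …, 0, w). Then det c = (det α)·(det d₁)^r. In particular, c is invertible if and only if α and d₁ are invertible. -/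
/-- If `f` and `g` preserve every term of a flag and `f - g` sends each term into the previous one,
then `f` and `g` have the same determinant. -/
theorem LinearMap.det_eq_det_of_flag {F : Type*} [Field F] (n : ℕ) :
    ∀ {V : Type*} [AddCommGroup V] [Module F V] [FiniteDimensional F V]
      (U : ℕ → Submodule F V) (f g : V →ₗ[F] V), U 0 = ⊥ → U n = ⊤ →
      (∀ k, U k ≤ (U k).comap f) → (∀ k, U k ≤ (U k).comap g) →
      (∀ k, U (k + 1) ≤ (U k).comap (f - g)) → LinearMap.det f = LinearMap.det g := by
  induction n with
  | zero =>
    intro V _ _ _ U f g h₀ h_top _ _ _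
    have : Subsingleton V :=
      (Submodule.subsingleton_iff F).mp (subsingleton_of_bot_eq_top (h₀.symm.trans h_top))
    rw [Subsingleton.elim f g]
  | succ n ih =>
    intro V _ _ _ U f g h₀ h_top hf hg hfg
    rw [LinearMap.det_eq_det_mul_det (U n) f (hf n), LinearMap.det_eq_det_mul_det (U n) g (hg n)]
    congr 1
    · refine ih (fun k => (U k).comap (U n).subtype) _ _ ?_ ?_ (fun k x hx => hf k hx)
        (fun k x hx => hg k hx) (fun k x hx => hfg k hx)
      · rw [h₀]
        exact Submodule.ker_subtype _
      · exact Submodule.comap_subtype_self _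
    · congr 1
      ext x
      exact (Submodule.Quotient.eq _).mpr (hfg n (h_top ▸ Submodule.mem_top))

/-- The sequence of submodules `⊥, P, X⁻¹(⊥), X⁻¹(P), X⁻²(⊥), X⁻²(P), …`. -/
def interleavedFlag {F V : Type*} [Field F] [AddCommGroup V] [Module F V]
    (X : V →ₗ[F] V) (P : Submodule F V) : ℕ → Submodule F V
  | 0 => ⊥
  | 1 => P
  | k + 2 => (interleavedFlag X P k).comap X

theorem interleavedFlag_two_mul {F V : Type*} [Field F] [AddCommGroup V] [Module F V]
    (X : V →ₗ[F] V) (P : Submodule F V) (n : ℕ) :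
    interleavedFlag X P (2 * n) = LinearMap.ker (X ^ n) := by
  induction n with
  | zero => simp [interleavedFlag, Module.End.one_eq_id]
  | succ n ih =>
    rw [Nat.mul_succ, interleavedFlag, ih, pow_succ, Module.End.mul_eq_comp, LinearMap.ker_comp]

theorem interleavedFlag_le_comap {F V : Type*} [Field F] [AddCommGroup V] [Module F V]
    {X f : V →ₗ[F] V} {P : Submodule F V} (hf : Commute f X) (hP : P ≤ P.comap f) (k : ℕ) :
    interleavedFlag X P k ≤ (interleavedFlag X P k).comap f := by
  induction k using Nat.twoStepInduction with
  | zero => exact bot_le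
  | one => exact hP
  | more k ih _ =>
    intro x hx
    change X (f x) ∈ interleavedFlag X P k
    rw [← show f (X x) = X (f x) from LinearMap.congr_fun hf x]
    exact ih hx

theorem interleavedFlag_succ_le_comap {F V : Type*} [Field F] [AddCommGroup V] [Module F V]
    {X e : V →ₗ[F] V} {P : Submodule F V} (he : Commute e X) (hP : ∀ x ∈ P, e x = 0)
    (hker : ∀ x, X x = 0 → e x ∈ P) (k : ℕ) :
    interleavedFlag X P (k + 1) ≤ (interleavedFlag X P k).comap e := by
  induction k using Nat.twoStepInduction with
  | zero => exact hP
  | one => exact hker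
  | more k ih _ =>
    intro x hx
    change X (e x) ∈ interleavedFlag X P k
    rw [← show e (X x) = X (e x) from LinearMap.congr_fun he x]
    exact ih hx

/-- Two endomorphisms commuting with a nilpotent `X` and preserving `P` have the same determinant
if they agree on `P` and are congruent modulo `P` on the kernel of `X`. -/
theorem LinearMap.det_eq_det_of_commute {F V : Type*} [Field F] [AddCommGroup V] [Module F V]
    [FiniteDimensional F V] {X f g : V →ₗ[F] V} (hX : IsNilpotent X) (hf : Commute f X)
    (hg : Commute g X) {P : Submodule F V} (hfP : P ≤ P.comap f) (hgP : P ≤ P.comap g)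
    (hP : ∀ x ∈ P, (f - g) x = 0) (hker : ∀ x, X x = 0 → (f - g) x ∈ P) :
    LinearMap.det f = LinearMap.det g := by
  obtain ⟨n, hn⟩ := hX
  refine LinearMap.det_eq_det_of_flag (2 * n) (interleavedFlag X P) f g rfl ?_
    (interleavedFlag_le_comap hf hfP) (interleavedFlag_le_comap hg hgP)
    (interleavedFlag_succ_le_comap (hf.sub_left hg) hP hker)
  rw [interleavedFlag_two_mul, hn, LinearMap.ker_zero]

theorem LinearMap.bijective_iff_isUnit_det {F V : Type*} [Field F] [AddCommGroup V] [Module F V]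
    [FiniteDimensional F V] (f : V →ₗ[F] V) :
    Function.Bijective f ↔ IsUnit (LinearMap.det f) := by
  rw [← LinearMap.isUnit_iff_isUnit_det, Module.End.isUnit_iff]

/-- Powers of the direct sum of `X₁` with a shift of `r` blocks. -/
theorem pow_prod_shift_apply {F V₁ W : Type*} [Field F] [AddCommGroup V₁] [Module F V₁]
    [AddCommGroup W] [Module F W] {r : ℕ} {X₁ : V₁ →ₗ[F] V₁}
    {X : (V₁ × (Fin r → W)) →ₗ[F] (V₁ × (Fin r → W))}
    (hX : ∀ (v₁ : V₁) (w : Fin r → W),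
      X (v₁, w) = (X₁ v₁, fun i : Fin r =>
        if h : (i : ℕ) + 1 < r then w ⟨(i : ℕ) + 1, h⟩ else 0))
    (k : ℕ) (v₁ : V₁) (w : Fin r → W) :
    (X ^ k) (v₁, w) = ((X₁ ^ k) v₁, fun i : Fin r =>
      if h : (i : ℕ) + k < r then w ⟨(i : ℕ) + k, h⟩ else 0) := by
  induction k with
  | zero => simp
  | succ k ih =>
    rw [pow_succ', Module.End.mul_apply, ih, hX, pow_succ', Module.End.mul_apply]
    congr 1
    funext i
    by_cases h : (i : ℕ) + (k + 1) < r
    · have h₁ : (i : ℕ) + 1 < r := by omega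
      have h₂ : (i : ℕ) + 1 + k < r := by omega
      simp only [h, h₁, h₂, dite_true]
      congr 2
      omega
    · have h₂ : ¬ (i : ℕ) + 1 + k < r := by omega
      simp [h, h₂]


/-- Let `V = V₁ × W^r`, `X(v₁, w₁, …, w_r) = (X₁v₁, w₂, …, w_r, 0)` with `X₁^{r−1} = 0`.
If `c` is an endomorphism of `V` commuting with `X`, `α(v₁)` is the `V₁`-component of
`c(v₁, 0, …, 0)` and `d₁(w)` is the `r`-th `W`-component of `c(0, …, 0, w)`, then
`det c = det α · (det d₁)^r`; in particular `c` is invertible iff `α` and `d₁` are. -/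
theorem statement8 {F V₁ W : Type*} [Field F] [AddCommGroup V₁] [Module F V₁]
    [AddCommGroup W] [Module F W] [FiniteDimensional F V₁] [FiniteDimensional F W]
    {r : ℕ} (hr : 1 ≤ r)
    (X₁ : V₁ →ₗ[F] V₁) (hX₁ : X₁ ^ (r - 1) = 0)
    (X : (V₁ × (Fin r → W)) →ₗ[F] (V₁ × (Fin r → W)))
    (hX : ∀ (v₁ : V₁) (w : Fin r → W),
      X (v₁, w) = (X₁ v₁, fun i : Fin r =>
        if h : (i : ℕ) + 1 < r then w ⟨(i : ℕ) + 1, h⟩ else 0))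
    (c : (V₁ × (Fin r → W)) →ₗ[F] (V₁ × (Fin r → W)))
    (hc : c ∘ₗ X = X ∘ₗ c)
    (α : V₁ →ₗ[F] V₁) (hα : ∀ v₁ : V₁, α v₁ = (c (v₁, 0)).1)
    (d₁ : W →ₗ[F] W)
    (hd₁ : ∀ w : W, d₁ w =
      (c (0, fun i : Fin r => if (i : ℕ) = r - 1 then w else 0)).2 ⟨r - 1, by omega⟩) :
    LinearMap.det c = LinearMap.det α * (LinearMap.det d₁) ^ r ∧
      (Function.Bijective c ↔ Function.Bijective α ∧ Function.Bijective d₁) := by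
  have hdet : LinearMap.det c = LinearMap.det α * (LinearMap.det d₁) ^ r := by
    let g : (V₁ × (Fin r → W)) →ₗ[F] (V₁ × (Fin r → W)) :=
      α.prodMap (LinearMap.pi fun i => d₁.comp (LinearMap.proj i))
    have hg : LinearMap.det g = LinearMap.det α * (LinearMap.det d₁) ^ r := by
      rw [LinearMap.det_prodMap, LinearMap.det_pi]
      simp
    have hg_apply (v : V₁) (w : Fin r → W) : g (v, w) = (α v, fun i => d₁ (w i)) := rfl
    have hcX (x) : c (X x) = X (c x) := LinearMap.congr_fun hc x
    have hX_fst (x) : (X x).1 = X₁ x.1 := by rw [← Prod.mk.eta (p := x), hX]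
    have hαX (v : V₁) : α (X₁ v) = X₁ (α v) := by
      have h : X (v, 0) = (X₁ v, 0) := by
        rw [hX]
        congr 1
        funext i
        simp
      rw [hα, ← h, hcX, hX_fst, ← hα]
    have hcX' : Commute c X := hc
    have hgX : Commute g X := by
      refine LinearMap.ext fun ⟨v, w⟩ => ?_
      rw [Module.End.mul_apply, Module.End.mul_apply, hX, hg_apply, hg_apply, hX, hαX]
      congr 1
      funext i
      split_ifs <;> simp
    have heX : Commute (c - g) X := hcX'.sub_left hgX
    have hle {f : (V₁ × (Fin r → W)) →ₗ[F] (V₁ × (Fin r → W))} (hf : Commute f X) :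
        LinearMap.range (X ^ (r - 1)) ≤ (LinearMap.range (X ^ (r - 1))).comap f := by
      rintro _ ⟨x, rfl⟩
      exact ⟨f x, (LinearMap.congr_fun (hf.pow_right (r - 1)) x).symm⟩
    have hpow (x y : V₁ × (Fin r → W)) (h : x.2 ⟨r - 1, by omega⟩ = y.2 ⟨r - 1, by omega⟩) :
        (X ^ (r - 1)) x = (X ^ (r - 1)) y := by
      obtain ⟨v, w⟩ := x
      obtain ⟨v', w'⟩ := y
      rw [pow_prod_shift_apply hX, pow_prod_shift_apply hX, hX₁]
      congr 1
      funext i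
      split_ifs with hi
      · have h_idx : (⟨(i : ℕ) + (r - 1), hi⟩ : Fin r) = ⟨r - 1, by omega⟩ := by
          ext
          simp only
          omega
        rw [h_idx]
        exact h
      · rfl
    have hP : ∀ x ∈ LinearMap.range (X ^ (r - 1)), (c - g) x = 0 := by
      rintro _ ⟨x, rfl⟩
      rw [hpow x (0, fun i : Fin r => if (i : ℕ) = r - 1 then x.2 ⟨r - 1, by omega⟩ else 0)
        (by simp)]
      refine (LinearMap.congr_fun (heX.pow_right (r - 1)) _).trans ?_
      rw [Module.End.mul_apply, hpow _ 0, map_zero]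
      rw [LinearMap.sub_apply, Prod.snd_sub, Pi.sub_apply, ← hd₁, hg_apply]
      simp
    have hker_range (w : Fin r → W) (h : X (0, w) = 0) :
        (0, w) ∈ LinearMap.range (X ^ (r - 1)) := by
      refine ⟨(0, fun _ => w ⟨0, by omega⟩), ?_⟩
      rw [pow_prod_shift_apply hX, map_zero]
      congr 1
      funext i
      rcases i with ⟨_ | j, hj⟩
      · simp [show r - 1 < r by omega]
      · have := congr_fun (congr_arg Prod.snd h) ⟨j, by omega⟩
        rw [hX] at this
        simpa [hj, show ¬ j + 1 + (r - 1) < r by omega] using this.symm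
    have hker : ∀ x, X x = 0 → (c - g) x ∈ LinearMap.range (X ^ (r - 1)) := by
      rintro ⟨v, w⟩ hx
      have hx' := hx
      rw [hX, Prod.mk_eq_zero] at hx'
      have hw : X (0, w) = 0 := by rw [hX, map_zero, hx'.2]; rfl
      have hv : X (v, 0) = 0 := by
        rw [show ((v, 0) : V₁ × (Fin r → W)) = (v, w) - (0, w) by simp, map_sub, hx, hw, sub_zero]
      have hfst : ((c - g) (v, 0)).1 = 0 := by
        rw [LinearMap.sub_apply, Prod.fst_sub, ← hα, hg_apply, sub_self]
      have hXe : X ((c - g) (v, 0)) = 0 := by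
        rw [← show (c - g) (X (v, 0)) = X ((c - g) (v, 0)) from LinearMap.congr_fun heX _, hv,
          map_zero]
      rw [show ((v, w) : V₁ × (Fin r → W)) = (v, 0) + (0, w) by simp, map_add,
        hP _ (hker_range w hw), add_zero]
      generalize (c - g) (v, 0) = y at hfst hXe
      obtain ⟨y₁, y₂⟩ := y
      obtain rfl : y₁ = 0 := hfst
      exact hker_range y₂ hXe
    have hnil : IsNilpotent X := by
      refine ⟨r, LinearMap.ext fun ⟨v, w⟩ => ?_⟩
      rw [pow_prod_shift_apply hX, pow_eq_zero_of_le (Nat.sub_le r 1) hX₁]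
      simp
      rfl
    rw [← hg]
    exact LinearMap.det_eq_det_of_commute hnil hcX' hgX (hle hcX') (hle hgX) hP hker
  refine ⟨hdet, ?_⟩
  rw [LinearMap.bijective_iff_isUnit_det, LinearMap.bijective_iff_isUnit_det,
    LinearMap.bijective_iff_isUnit_det, hdet, IsUnit.mul_iff, isUnit_pow_iff (by omega)]
end

section
/- Let F be a field, V a finite-dimensional F-vector space, and X a nilpotent endomorphism of V with X^r = 0 (r ≥ 1). Then the group C = {c ∈ GL(V) : c∘X = X∘c} of invertible endomorphisms commuting with X acts transitively on the set {v ∈ V : X^{r−1} v ≠ 0}: this set is stable under C, and for any v, v' with X^{r−1} v ≠ 0 and X^{r−1} v' ≠ 0 there exists c ∈ GL(V) commuting with X such that c(v) = v'. In other words, {v ∈ V : X^{r−1} v ≠ 0} is a single C-orbit. -/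
/-- A linear map commuting with a nilpotent `X` is injective once it is injective on `ker X`. -/
theorem LinearMap.injective_of_commute_nilpotent {R M : Type*} [Ring R] [AddCommGroup M]
    [Module R M] {X c : M →ₗ[R] M} (hX : IsNilpotent X) (hc : ∀ x, c (X x) = X (c x))
    (hker : ∀ x, X x = 0 → c x = 0 → x = 0) : Function.Injective c := by
  obtain ⟨n, hn⟩ := hX
  have key : ∀ n : ℕ, ∀ x, (X ^ n) x = 0 → c x = 0 → x = 0 := by
    intro n
    induction n with
    | zero => intro x hx _; simpa using hx
    | succ n ih =>
      intro x hx hcx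
      refine hker x (ih (X x) ?_ ?_) hcx
      · rwa [pow_succ, Module.End.mul_apply] at hx
      · rw [hc, hcx, map_zero]
  rw [injective_iff_map_eq_zero]
  intro x hx
  exact key n x (by rw [hn, LinearMap.zero_apply]) hx

/-- Two nonzero vectors admit a linear form vanishing at neither of them. -/
theorem Module.exists_dual_apply_ne_zero_and_apply_ne_zero {F V : Type*} [Field F]
    [AddCommGroup V] [Module F V] {a b : V} (ha : a ≠ 0) (hb : b ≠ 0) :
    ∃ f : V →ₗ[F] F, f a ≠ 0 ∧ f b ≠ 0 := by
  obtain ⟨f, hf⟩ : ∃ f : V →ₗ[F] F, f a ≠ 0 := by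
    by_contra! h
    exact ha ((Module.forall_dual_apply_eq_zero_iff F a).1 h)
  obtain ⟨g, hg⟩ : ∃ g : V →ₗ[F] F, g b ≠ 0 := by
    by_contra! h
    exact hb ((Module.forall_dual_apply_eq_zero_iff F b).1 h)
  by_cases hfb : f b = 0
  · by_cases hga : g a = 0
    · exact ⟨f + g, by simpa [hga] using hf, by simpa [hfb] using hg⟩
    · exact ⟨g, hga, hg⟩
  · exact ⟨f, hf, hfb⟩

section NilpotentTransvection

variable {F V : Type*} [Field F] [AddCommGroup V] [Module F V]

/-- The bilinear expression `∑ i ≤ s, f (X ^ (s - i) x) • X ^ i w`, as an endomorphism in `w`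
for fixed `x`. -/
def nilpotentTransvection (X : V →ₗ[F] V) (s : ℕ) (f : V →ₗ[F] F) (x : V) : V →ₗ[F] V :=
  ∑ i ∈ Finset.range (s + 1), f ((X ^ (s - i)) x) • X ^ i

variable (X : V →ₗ[F] V) (s : ℕ) (f : V →ₗ[F] F)

theorem nilpotentTransvection_apply (x w : V) :
    nilpotentTransvection X s f x w =
      ∑ i ∈ Finset.range (s + 1), f ((X ^ (s - i)) x) • (X ^ i) w := by
  simp [nilpotentTransvection, LinearMap.sum_apply]

theorem nilpotentTransvection_apply_map (x w : V) :
    nilpotentTransvection X s f x (X w) = X (nilpotentTransvection X s f x w) := by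
  rw [nilpotentTransvection_apply, nilpotentTransvection_apply, map_sum]
  refine Finset.sum_congr rfl fun i _ => ?_
  rw [map_smul, ← Module.End.mul_apply, ← Module.End.mul_apply, ← pow_succ, ← pow_succ']

theorem nilpotentTransvection_map_apply (hX : X ^ (s + 1) = 0) (x w : V) :
    nilpotentTransvection X s f (X x) w = X (nilpotentTransvection X s f x w) := by
  simp only [nilpotentTransvection_apply, map_sum, map_smul, ← Module.End.mul_apply,
    ← pow_succ, ← pow_succ']
  rw [Finset.sum_range_succ', Finset.sum_range_succ]
  simp only [Nat.sub_zero, hX, LinearMap.zero_apply, map_zero, zero_smul, smul_zero, add_zero]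
  refine Finset.sum_congr rfl fun i hi => ?_
  have hi := Finset.mem_range.1 hi
  rw [show s - (i + 1) + 1 = s - i by omega]

theorem nilpotentTransvection_apply_of_map_eq_zero (x : V) {w : V} (hw : X w = 0) :
    nilpotentTransvection X s f x w = f ((X ^ s) x) • w := by
  rw [nilpotentTransvection_apply, Finset.sum_range_succ']
  simp [pow_succ, hw]

theorem nilpotentTransvection_apply_of_map_eq_zero_left {x : V} (hx : X x = 0) (w : V) :
    nilpotentTransvection X s f x w = f x • (X ^ s) w := by
  rw [nilpotentTransvection_apply, Finset.sum_range_succ, Finset.sum_eq_zero]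
  · simp
  · intro i hi
    have hi := Finset.mem_range.1 hi
    rw [show s - i = s - i - 1 + 1 by omega, pow_succ, Module.End.mul_apply, hx]
    simp

theorem pow_nilpotentTransvection_apply (hX : X ^ (s + 1) = 0) (x w : V) :
    (X ^ s) (nilpotentTransvection X s f x w) = f ((X ^ s) x) • (X ^ s) w := by
  have hcomm : ∀ n : ℕ, (X ^ n) (nilpotentTransvection X s f x w) =
      nilpotentTransvection X s f x ((X ^ n) w) := by
    intro n
    induction n with
    | zero => simp
    | succ n ih =>
      rw [pow_succ', Module.End.mul_apply, ih, Module.End.mul_apply,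
        nilpotentTransvection_apply_map]
  rw [hcomm]
  refine nilpotentTransvection_apply_of_map_eq_zero X s f x ?_
  rw [← Module.End.mul_apply, ← pow_succ', hX, LinearMap.zero_apply]

/-- `nilpotentTransvection` as an endomorphism in `x` for fixed `w`. -/
def nilpotentTransvectionFlip (w : V) : V →ₗ[F] V :=
  ∑ i ∈ Finset.range (s + 1), (f ∘ₗ X ^ (s - i)).smulRight ((X ^ i) w)

theorem nilpotentTransvectionFlip_apply (w x : V) :
    nilpotentTransvectionFlip X s f w x = nilpotentTransvection X s f x w := by
  simp [nilpotentTransvectionFlip, nilpotentTransvection_apply, LinearMap.sum_apply]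

end NilpotentTransvection

/-- Let `X` be a nilpotent endomorphism of a finite-dimensional vector space `V` with
`X^r = 0` (`r ≥ 1`).  The group of invertible endomorphisms commuting with `X` acts
transitively on `{v : X^{r−1} v ≠ 0}`: this set is stable under the action, and any two
of its points are related by an invertible endomorphism commuting with `X`. -/
theorem statement9 {F V : Type*} [Field F] [AddCommGroup V] [Module F V]
    [FiniteDimensional F V] {r : ℕ} (hr : 1 ≤ r)
    (X : V →ₗ[F] V) (hX : X ^ r = 0) :
    (∀ c : V ≃ₗ[F] V, c.toLinearMap ∘ₗ X = X ∘ₗ c.toLinearMap →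
      ∀ v : V, (X ^ (r - 1)) v ≠ 0 → (X ^ (r - 1)) (c v) ≠ 0) ∧
    (∀ v v' : V, (X ^ (r - 1)) v ≠ 0 → (X ^ (r - 1)) v' ≠ 0 →
      ∃ c : V ≃ₗ[F] V, c.toLinearMap ∘ₗ X = X ∘ₗ c.toLinearMap ∧ c v = v') := by
  obtain ⟨s, rfl⟩ : ∃ s, r = s + 1 := ⟨r - 1, by omega⟩
  simp only [Nat.add_sub_cancel]
  refine ⟨fun c hc v hv h => hv ?_, fun v v' hv hv' => ?_⟩
  · have hcomm : Commute c.toLinearMap (X ^ s) := Commute.pow_right hc s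
    have hcv : c ((X ^ s) v) = (X ^ s) (c v) := LinearMap.congr_fun hcomm.eq v
    rw [h] at hcv
    exact c.map_eq_zero_iff.1 hcv
  · obtain ⟨f, hf, hf'⟩ := Module.exists_dual_apply_ne_zero_and_apply_ne_zero (F := F) hv hv'
    have hinj : Function.Injective (nilpotentTransvection X s f v) := by
      refine LinearMap.injective_of_commute_nilpotent ⟨_, hX⟩
        (nilpotentTransvection_apply_map X s f v) fun x hx h => ?_
      rw [nilpotentTransvection_apply_of_map_eq_zero X s f v hx] at h
      exact (smul_eq_zero.1 h).resolve_left hf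
    obtain ⟨w, hw⟩ := LinearMap.injective_iff_surjective.1 hinj (v' - v)
    have hXw : f ((X ^ s) v) * f ((X ^ s) w) = f ((X ^ s) v') - f ((X ^ s) v) := by
      rw [← smul_eq_mul, ← map_smul, ← pow_nilpotentTransvection_apply X s f hX, hw, map_sub,
        map_sub]
    set c : V →ₗ[F] V := LinearMap.id + nilpotentTransvectionFlip X s f w
    have hc : ∀ x, c x = x + nilpotentTransvection X s f x w := fun x => by
      simp [c, nilpotentTransvectionFlip_apply]
    have hcX : ∀ x, c (X x) = X (c x) := fun x => by
      rw [hc, hc, map_add, nilpotentTransvection_map_apply X s f hX]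
    have hcinj : Function.Injective c := by
      refine LinearMap.injective_of_commute_nilpotent ⟨_, hX⟩ hcX fun x hx h => ?_
      rw [hc, nilpotentTransvection_apply_of_map_eq_zero_left X s f hx] at h
      have hfx : f x + f x * f ((X ^ s) w) = 0 := by
        simpa using congrArg f h
      have hfx0 : f x * f ((X ^ s) v') = 0 := by
        linear_combination f ((X ^ s) v) * hfx - f x * hXw
      rw [(mul_eq_zero.1 hfx0).resolve_right hf', zero_smul, add_zero] at h
      exact h
    refine ⟨LinearEquiv.ofInjectiveEndo c hcinj, ?_, ?_⟩
    · ext x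
      simpa using hcX x
    · rw [LinearEquiv.coe_ofInjectiveEndo, hc, hw, add_sub_cancel]
end

section
/- Let X be a skew-adjoint endomorphism of V and v ∈ V. Then the pair (X, v) is regular if and only if its G-orbit {(g∘X∘g⁻¹, g(v)) : g ∈ G} is a closed subset of End(V) × V and the stabilizer {g ∈ G : g∘X∘g⁻¹ = X, g(v) = v} is reduced to the identity. -/
open Topology

section SesquilinearAlgebra

variable {K : Type*} [Field K] {σ : K ≃+* K}
  {V : Type*} [AddCommGroup V] [Module K V] [FiniteDimensional K V]

/-- A family of conjugate-linear functionals is represented by a sesquilinear form which is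
nondegenerate on the left. -/
theorem LinearMap.exists_sesq_represent {W : Type*} [AddCommGroup W] [Module K W]
    (β : V →ₗ[K] V →ₛₗ[(σ : K →+* K)] K) (hnd : ∀ x, (∀ y, β x y = 0) → x = 0)
    (γ : W →ₗ[K] V →ₛₗ[(σ : K →+* K)] K) :
    ∃ S : W →ₗ[K] V, ∀ x y, β (S x) y = γ x y := by
  set b := Module.finBasis K V
  let ev : (V →ₛₗ[(σ : K →+* K)] K) →ₗ[K] (Fin (Module.finrank K V) → K) :=
    { toFun := fun f i => f (b i)
      map_add' := fun _ _ => rfl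
      map_smul' := fun _ _ => rfl }
  have hev : Function.Injective ev := fun f g h => b.ext fun i => congrFun h i
  have hinj : Function.Injective (ev ∘ₗ β) := by
    rw [injective_iff_map_eq_zero]
    intro x hx
    have : β x = 0 := hev (by simpa using hx)
    exact hnd x fun y => by simp [this]
  let e := LinearEquiv.ofInjectiveOfFinrankEq (ev ∘ₗ β) hinj (by simp)
  refine ⟨e.symm.toLinearMap ∘ₗ ev ∘ₗ γ, fun x y => ?_⟩
  have h : ev (β (e.symm (ev (γ x)))) = ev (γ x) := e.apply_symm_apply (ev (γ x))
  exact congrArg (fun f => f y) (hev h)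

/-- Every totally isotropic subspace is the range of an idempotent which is orthogonal to its
adjoint idempotent. -/
theorem LinearMap.exists_idempotent_of_isotropic [CharZero K]
    (β : V →ₗ[K] V →ₛₗ[(σ : K →+* K)] K) (hherm : ∀ x y, β y x = σ (β x y))
    (hnd : ∀ x, (∀ y, β x y = 0) → x = 0) (R : Submodule K V)
    (hR : ∀ x ∈ R, ∀ y ∈ R, β x y = 0) :
    ∃ P Q : Module.End K V, (∀ x y, β (P x) y = β x (Q y)) ∧ P * P = P ∧ Q * Q = Q ∧
      P * Q = 0 ∧ Q * P = 0 ∧ (∀ x, P x ∈ R) ∧ ∀ x ∈ R, P x = x := by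
  have hnd' : ∀ x y, (∀ z, β z x = β z y) → x = y := by
    intro x y h
    rw [← sub_eq_zero]
    refine hnd _ fun z => ?_
    rw [hherm z, map_sub, h z, sub_self, map_zero]
  obtain ⟨p, hp⟩ := R.subtype.exists_leftInverse_of_injective R.ker_subtype
  let T : Module.End K V := R.subtype ∘ₗ p
  have hTR : ∀ x, T x ∈ R := fun x => (p x).2
  have hTid : ∀ x ∈ R, T x = x := fun x hx =>
    congrArg Subtype.val (LinearMap.congr_fun hp ⟨x, hx⟩)
  obtain ⟨S, hS⟩ := LinearMap.exists_sesq_represent β hnd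
    { toFun := fun x => (β x).comp T
      map_add' := fun x y => by ext; simp
      map_smul' := fun c x => by ext; simp }
  replace hS : ∀ x y, β (S x) y = β x (T y) := hS
  have hTS : ∀ x y, β (T x) y = β x (S y) := fun x y => by
    rw [hherm y, ← hS, ← hherm]
  have hTT : T * T = T := by ext x; exact hTid _ (hTR x)
  have hSS : S * S = S := by
    ext x
    refine hnd' _ _ fun z => ?_
    rw [Module.End.mul_apply, ← hTS, ← hTS, ← hTS, hTid _ (hTR z)]
  have hST : S * T = 0 := by
    ext x
    refine hnd' _ _ fun z => ?_
    rw [Module.End.mul_apply, ← hTS, hR _ (hTR z) _ (hTR x)]; simp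
  have hTT' : ∀ Z, T * (T * Z) = T * Z := fun Z => by rw [← mul_assoc, hTT]
  have hST' : ∀ Z, S * (T * Z) = 0 := fun Z => by rw [← mul_assoc, hST, zero_mul]
  refine ⟨T - (2⁻¹ : K) • (T * S), S - (2⁻¹ : K) • (T * S), fun x y => ?_, ?_, ?_, ?_, ?_,
    fun x => ?_, fun x hx => ?_⟩
  · simp [hTS, hS, map_ofNat σ 2]
  · simp [sub_mul, mul_sub, mul_assoc, hTT, hST, hTT', hST']
  · simp [sub_mul, mul_sub, mul_assoc, hSS, hST']
  · simp only [sub_mul, mul_sub, mul_assoc, hSS, hTT', hST', smul_mul_assoc,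
      mul_smul_comm, mul_zero, smul_zero, sub_zero]
    rw [sub_sub, ← add_smul, ← two_mul, mul_inv_cancel₀ two_ne_zero, one_smul, sub_self]
  · simp [sub_mul, mul_sub, mul_assoc, hST, hST']
  · exact R.sub_mem (hTR x) (R.smul_mem _ (hTR _))
  · have : S x = 0 := by
      rw [← hTid x hx]; exact LinearMap.congr_fun hST x
    simp [this, hTid x hx]

end SesquilinearAlgebra

/-- Conjugating a block upper triangular element by a block scalar element. -/
theorem conj_block_triangular {K A : Type*} [Field K] [Ring A] [Algebra K A]
    {P Q X : A} (hPP : P * P = P) (hQQ : Q * Q = Q) (hQP : Q * P = 0)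
    (hXP : X * P = P * X * P) (hQX : Q * X = Q * X * Q) {t s : K} (ht : t ≠ 0) (hs : s ≠ 0) :
    (t • P + (1 - P - Q) + s⁻¹ • Q) * X * (t⁻¹ • P + (1 - P - Q) + s • Q) =
      (P * X * P + (1 - P - Q) * X * (1 - P - Q) + Q * X * Q) + t • (P * X * (1 - P - Q)) +
        (t * s) • (P * X * Q) + s • ((1 - P - Q) * X * Q) := by
  set E := 1 - P - Q with hE
  have hEP : E * P = 0 := by simp [hE, sub_mul, hPP, hQP]
  have hQE : Q * E = 0 := by simp [hE, mul_sub, hQQ, hQP]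
  have hEXP : E * X * P = 0 := by rw [mul_assoc, hXP, mul_assoc, ← mul_assoc, hEP, zero_mul]
  have hQXP : Q * X * P = 0 := by rw [hQX, mul_assoc, hQP, mul_zero]
  have hQXE : Q * X * E = 0 := by rw [hQX, mul_assoc, hQE, mul_zero]
  simp only [add_mul, mul_add, smul_mul_assoc, mul_smul_comm, hEXP, hQXP, hQXE, smul_zero,
    smul_add, smul_smul, inv_mul_cancel₀ ht, mul_inv_cancel₀ hs, one_smul]
  rw [mul_comm s t]
  abel

/-- A block diagonal element commutes with a block scalar element. -/
theorem commute_block_diagonal {K A : Type*} [Field K] [Ring A] [Algebra K A]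
    {P Q : A} (hPP : P * P = P) (hQQ : Q * Q = Q) (hPQ : P * Q = 0) (hQP : Q * P = 0)
    (X : A) (t s : K) :
    Commute (t • P + (1 - P - Q) + s • Q)
      (P * X * P + (1 - P - Q) * X * (1 - P - Q) + Q * X * Q) := by
  obtain ⟨E, hE⟩ : ∃ E, E = 1 - P - Q := ⟨_, rfl⟩
  have hEP : E * P = 0 := by simp [hE, sub_mul, hPP, hQP]
  have hEQ : E * Q = 0 := by simp [hE, sub_mul, hQQ, hPQ]
  have hPE : P * E = 0 := by simp [hE, mul_sub, hPP, hPQ]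
  have hQE : Q * E = 0 := by simp [hE, mul_sub, hQQ, hQP]
  have hEE : E * E = E := by nth_rewrite 2 [hE]; simp [mul_sub, hEP, hEQ]
  rw [← hE, commute_iff_eq]
  simp only [add_mul, mul_add, smul_mul_assoc, mul_smul_comm, mul_assoc, hPP, hQQ, hPQ, hQP, hEP,
    hEQ, hPE, hQE, hEE, mul_zero, add_zero, zero_add]
  simp only [← mul_assoc, hPP, hQQ, hPQ, hQP, hEP,
    hEQ, hPE, hQE, hEE, zero_mul, smul_zero, add_zero, zero_add]

/-- Regularity only has to be tested on the span of all iterates. -/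
theorem linearIndependent_and_span_pow_iff {K V : Type*} [Field K] [AddCommGroup V] [Module K V]
    [FiniteDimensional K V] {n : ℕ} (hdim : Module.finrank K V = n) (X : Module.End K V) (v : V) :
    (LinearIndependent K (fun i : Fin n => (X ^ (i : ℕ)) v) ∧
        Submodule.span K (Set.range fun i : Fin n => (X ^ (i : ℕ)) v) = ⊤) ↔
      Submodule.span K (Set.range fun i : ℕ => (X ^ i) v) = ⊤ := by
  constructor
  · rintro ⟨-, h⟩
    rw [eq_top_iff, ← h]
    exact Submodule.span_mono (Set.range_subset_iff.mpr fun i => ⟨i, rfl⟩)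
  · intro h
    have hspan : Submodule.span K (Set.range fun i : Fin n => (X ^ (i : ℕ)) v) = ⊤ := by
      rw [eq_top_iff, ← h, Submodule.span_le]
      rintro _ ⟨m, rfl⟩
      rcases subsingleton_or_nontrivial V with hV | hV
      · rw [Subsingleton.elim ((fun i : ℕ => (X ^ i) v) m) 0]
        exact Submodule.zero_mem _
      have hlt : (Polynomial.X ^ m %ₘ X.charpoly).natDegree < n := by
        rw [← hdim, ← LinearMap.charpoly_natDegree X]
        refine Polynomial.natDegree_modByMonic_lt _ X.charpoly_monic fun h1 => ?_
        have := X.charpoly_natDegree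
        rw [h1, Polynomial.natDegree_one] at this
        exact Module.finrank_pos.ne this
      simp only [SetLike.mem_coe]
      rw [LinearMap.pow_eq_aeval_mod_charpoly, Polynomial.aeval_eq_sum_range' hlt,
        LinearMap.sum_apply]
      refine Submodule.sum_mem _ fun i hi => ?_
      exact Submodule.smul_mem _ _
        (Submodule.subset_span ⟨⟨i, Finset.mem_range.mp hi⟩, rfl⟩)
    exact ⟨linearIndependent_of_top_le_span_of_card_eq_finrank hspan.ge (by simp [hdim]), hspan⟩

theorem ContinuousLinearEquiv.conj_eq_iff
    {K V : Type*} [NontriviallyNormedField K] [NormedAddCommGroup V] [NormedSpace K V]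
    {g : V ≃L[K] V} {X Y : V →L[K] V} :
    Y = (g : V →L[K] V).comp (X.comp (g.symm : V →L[K] V)) ↔ ∀ x, g (X x) = Y (g x) := by
  constructor
  · rintro rfl x
    simp
  · intro h
    ext x
    simp [h]

theorem ContinuousLinearMap.pow_conj
    {K V : Type*} [NontriviallyNormedField K] [NormedAddCommGroup V] [NormedSpace K V]
    {g : V ≃L[K] V} {X Y : V →L[K] V}
    (h : ∀ x, g (X x) = Y (g x)) (i : ℕ) (x : V) : g ((X ^ i) x) = (Y ^ i) (g x) := by
  induction i generalizing x with
  | zero => simp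
  | succ i ih => rw [pow_succ, pow_succ, mul_apply_eq_comp, ih, h, mul_apply_eq_comp]

section SesquilinearTopology

variable {K : Type*} [NontriviallyNormedField K] [CompleteSpace K] {σ : K ≃+* K}
  {V : Type*} [NormedAddCommGroup V] [NormedSpace K V] [FiniteDimensional K V]

/-- A sesquilinear form over a complete field with continuous involution is continuous. -/
theorem LinearMap.continuous_sesq (hσc : Continuous σ) (β : V →ₗ[K] V →ₛₗ[(σ : K →+* K)] K) :
    Continuous fun p : V × V => β p.1 p.2 := by
  let b := Module.finBasis K V
  have h : ∀ p : V × V, β p.1 p.2 = ∑ i, σ (b.coord i p.2) * β.flip (b i) p.1 := fun p => by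
    conv_lhs => rw [← b.sum_repr p.2]
    simp only [map_sum, LinearMap.map_smulₛₗ, smul_eq_mul]
    rfl
  simp_rw [h]
  refine continuous_finsetSum _ fun i _ => Continuous.mul ?_ ?_
  · exact hσc.comp ((b.coord i).continuous_of_finiteDimensional.comp continuous_snd)
  · exact (β.flip (b i)).continuous_of_finiteDimensional.comp continuous_fst

/-- The orbit of `(X, v)` under the isometries of a sesquilinear form. -/
def unitaryOrbit (β : V →ₗ[K] V →ₛₗ[(σ : K →+* K)] K) (X : V →L[K] V) (v : V) :
    Set ((V →L[K] V) × V) :=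
  {p | ∃ g : V ≃L[K] V, (∀ a b : V, β (g a) (g b) = β a b) ∧
    p = ((g : V →L[K] V).comp (X.comp (g.symm : V →L[K] V)), g v)}

/-- The stabilizer of `(X, v)` in the group of isometries of a sesquilinear form is trivial. -/
def HasTrivialUnitaryStabilizer (β : V →ₗ[K] V →ₛₗ[(σ : K →+* K)] K) (X : V →L[K] V) (v : V) :
    Prop :=
  ∀ g : V ≃L[K] V, (∀ a b : V, β (g a) (g b) = β a b) →
    (g : V →L[K] V).comp (X.comp (g.symm : V →L[K] V)) = X → g v = v →
      g = ContinuousLinearEquiv.refl K V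

omit [CompleteSpace K] [FiniteDimensional K V] in
theorem hasTrivialUnitaryStabilizer_of_span (β : V →ₗ[K] V →ₛₗ[(σ : K →+* K)] K)
    (X : V →L[K] V) (v : V) (h : Submodule.span K (Set.range fun i : ℕ => (X ^ i) v) = ⊤) :
    HasTrivialUnitaryStabilizer β X v := by
  intro g _ hgX hgv
  have hc := ContinuousLinearMap.pow_conj (ContinuousLinearEquiv.conj_eq_iff.mp hgX.symm)
  ext x
  have : (g : V →ₗ[K] V) = LinearMap.id :=
    LinearMap.ext_on_range h fun i => (hc i v).trans (congrArg _ hgv)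
  exact LinearMap.congr_fun this x

/-- The orbit of a regular pair is cut out by its Gram matrix. -/
theorem isClosed_unitaryOrbit_of_span (hσc : Continuous σ)
    (β : V →ₗ[K] V →ₛₗ[(σ : K →+* K)] K) (hnd : ∀ x, (∀ y, β x y = 0) → x = 0)
    (X : V →L[K] V) (v : V) (h : Submodule.span K (Set.range fun i : ℕ => (X ^ i) v) = ⊤) :
    IsClosed (unitaryOrbit β X v) := by
  have heq : unitaryOrbit β X v =
      {p | ∀ i j : ℕ, β ((p.1 ^ i) p.2) ((p.1 ^ j) p.2) = β ((X ^ i) v) ((X ^ j) v)} := by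
    ext ⟨Y, w⟩
    constructor
    · rintro ⟨g, hg, hp⟩ i j
      obtain ⟨hY, rfl⟩ := Prod.mk.inj hp
      have hc := ContinuousLinearMap.pow_conj (ContinuousLinearEquiv.conj_eq_iff.mp hY)
      simp only [← hc, hg]
    · intro hG
      change ∀ i j : ℕ, β ((Y ^ i) w) ((Y ^ j) w) = β ((X ^ i) v) ((X ^ j) v) at hG
      have hpow (Z : V →L[K] V) (i : ℕ) (x : V) : ((Z : Module.End K V) ^ i) x = (Z ^ i) x := by
        rw [← ContinuousLinearMap.toLinearMap_pow]; rfl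
      obtain ⟨hli, hsp⟩ := (linearIndependent_and_span_pow_iff rfl (X : Module.End K V) v).mpr
        (by simpa only [hpow] using h)
      simp only [hpow] at hli hsp
      let b := Module.Basis.mk hli hsp.ge
      have hb : ∀ i, b i = (X ^ (i : ℕ)) v := fun i => by simp [b]
      let L : V →ₗ[K] V := b.constr K fun i => (Y ^ (i : ℕ)) w
      have hL : ∀ i : Fin _, L ((X ^ (i : ℕ)) v) = (Y ^ (i : ℕ)) w := fun i => by
        rw [← hb, Module.Basis.constr_basis]
      have hLL : ∀ x y, β (L x) (L y) = β x y := by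
        intro x y
        have h1 : ∀ i, (β (L (b i))).comp L = β (b i) := fun i =>
          b.ext fun j => by rw [LinearMap.comp_apply, hb, hb, hL, hL, hG]
        have h2 : (β.flip (L y)) ∘ₗ L = β.flip y :=
          b.ext fun i => LinearMap.congr_fun (h1 i) y
        exact LinearMap.congr_fun h2 x
      have hinj : Function.Injective L := by
        rw [injective_iff_map_eq_zero]
        intro x hx
        exact hnd x fun y => by rw [← hLL, hx]; simp
      let e := (LinearEquiv.ofInjectiveEndo L hinj).toContinuousLinearEquiv
      have he : ∀ x, e x = L x := fun _ => rfl
      -- the images of all iterates are determined by pairing with the basis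
      have hLb : ∀ z w', (∀ j, β z (L (b j)) = β w' (L (b j))) → z = w' := by
        intro z w' hz
        rw [← sub_eq_zero]
        refine hnd _ fun y => ?_
        have : (β (z - w')).comp L = 0 := b.ext fun j => by simp [hz]
        rw [← e.apply_symm_apply y]
        exact LinearMap.congr_fun this _
      have hpowL : ∀ i : ℕ, i ≤ Module.finrank K V → L ((X ^ i) v) = (Y ^ i) w := by
        intro i hi
        rcases hi.lt_or_eq with hi | hi
        · exact hL ⟨i, hi⟩
        · refine hLb _ _ fun j => ?_
          rw [hLL, hb, hL, hG]
      refine ⟨e, fun x y => hLL x y, Prod.ext ?_ ?_⟩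
      · rw [ContinuousLinearEquiv.conj_eq_iff]
        have : L ∘ₗ (X : V →ₗ[K] V) = (Y : V →ₗ[K] V) ∘ₗ L := by
          refine b.ext fun i => ?_
          have h1 := hpowL (i + 1) i.2
          rw [pow_succ', pow_succ'] at h1
          rw [LinearMap.comp_apply, LinearMap.comp_apply, hb, hL]
          exact h1
        exact fun x => LinearMap.congr_fun this x
      · exact (hpowL 0 (Nat.zero_le _)).symm
  rw [heq]
  simp only [Set.ofPred_forall]
  refine isClosed_iInter fun i => isClosed_iInter fun j => isClosed_eq ?_ continuous_const
  have hc : ∀ i : ℕ, Continuous fun p : (V →L[K] V) × V => (p.1 ^ i) p.2 := fun i =>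
    (continuous_fst.pow i).clm_apply continuous_snd
  exact (LinearMap.continuous_sesq hσc β).comp ((hc i).prodMk (hc j))

/-- If the orbit of `(X, v)` is closed and its stabilizer is trivial, then there is no nonzero
`X`-invariant totally isotropic subspace orthogonal to `v`. -/
theorem eq_bot_of_isClosed_unitaryOrbit [CharZero K] (hσ : ∀ d, σ (σ d) = d)
    (hσc : Continuous σ) (β : V →ₗ[K] V →ₛₗ[(σ : K →+* K)] K)
    (hherm : ∀ x y, β y x = σ (β x y)) (hnd : ∀ x, (∀ y, β x y = 0) → x = 0)
    (X : V →L[K] V) (hX : ∀ a b, β (X a) b = -β a (X b)) (v : V)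
    (hcl : IsClosed (unitaryOrbit β X v)) (hst : HasTrivialUnitaryStabilizer β X v)
    (R : Submodule K V) (hR : ∀ x ∈ R, ∀ y ∈ R, β x y = 0) (hRX : ∀ x ∈ R, X x ∈ R)
    (hRv : ∀ x ∈ R, β x v = 0) : R = ⊥ := by
  have hnd' : ∀ x y, (∀ z, β z x = β z y) → x = y := by
    intro x y h
    rw [← sub_eq_zero]
    refine hnd _ fun z => ?_
    rw [hherm z, map_sub, h z, sub_self, map_zero]
  obtain ⟨P', Q', hadj', hPP', hQQ', hPQ', hQP', hPR', hRP'⟩ :=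
    LinearMap.exists_idempotent_of_isotropic β hherm hnd R hR
  obtain ⟨P, rfl⟩ : ∃ P : V →L[K] V, (P : V →ₗ[K] V) = P' := ⟨LinearMap.toContinuousLinearMap P', rfl⟩
  obtain ⟨Q, rfl⟩ : ∃ Q : V →L[K] V, (Q : V →ₗ[K] V) = Q' := ⟨LinearMap.toContinuousLinearMap Q', rfl⟩
  have hadj : ∀ x y, β (P x) y = β x (Q y) := hadj'
  have hadj2 : ∀ x y, β (Q x) y = β x (P y) := fun x y => by rw [hherm y, ← hadj, ← hherm]
  have hPR : ∀ x, P x ∈ R := hPR'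
  have hRP : ∀ x ∈ R, P x = x := hRP'
  have hPP : P * P = P := by ext x; exact LinearMap.congr_fun hPP' x
  have hQQ : Q * Q = Q := by ext x; exact LinearMap.congr_fun hQQ' x
  have hPQ : P * Q = 0 := by ext x; exact LinearMap.congr_fun hPQ' x
  have hQP : Q * P = 0 := by ext x; exact LinearMap.congr_fun hQP' x
  have hXP : X * P = P * X * P := by
    ext x
    exact (hRP _ (hRX _ (hPR x))).symm
  have hQX : Q * X = Q * X * Q := by
    ext x
    refine hnd' _ _ fun z => ?_
    change β z (Q (X x)) = β z (Q (X (Q x)))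
    have h := congrArg (fun T : V →L[K] V => T z) hXP
    change X (P z) = P (X (P z)) at h
    rw [← hadj, ← hadj, ← neg_inj, ← hX, ← hX, ← hadj, ← h]
  have hQv : Q v = 0 := hnd' _ _ fun z => by rw [← hadj, hRv _ (hPR z)]; simp
  let a (t s : K) : V →L[K] V := t • P + (1 - P - Q) + s⁻¹ • Q
  have ha (t s : K) (ht : t ≠ 0) (hs : s ≠ 0) : a t s * a t⁻¹ s⁻¹ = 1 := by
    have h := conj_block_triangular (X := 1) hPP hQQ hQP (by simp [hPP]) (by simp [hQQ]) ht hs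
    simp only [mul_one, sub_mul, mul_sub, one_mul, hPP, hQQ, hPQ, hQP] at h
    simp only [a, inv_inv]
    rw [h]
    simp only [sub_self, sub_zero, smul_zero, add_zero]
    abel
  have hs0 {t : K} (ht : t ≠ 0) : σ t ≠ 0 := by simpa using ht
  let g (t : K) (ht : t ≠ 0) : V ≃L[K] V :=
    ContinuousLinearEquiv.equivOfInverse (a t (σ t)) (a t⁻¹ (σ t)⁻¹)
      (fun x => by
        have := ha t⁻¹ (σ t)⁻¹ (inv_ne_zero ht) (inv_ne_zero (hs0 ht))
        rw [inv_inv, inv_inv] at this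
        exact congrArg (fun T : V →L[K] V => T x) this)
      (fun x => congrArg (fun T : V →L[K] V => T x) (ha t (σ t) ht (hs0 ht)))
  have hg (t : K) (ht : t ≠ 0) (x y : V) : β (g t ht x) (g t ht y) = β x y := by
    have h1 (z : V) : β (a t (σ t) x) z = β x (a t⁻¹ (σ t)⁻¹ z) := by
      simp [a, hadj, hadj2, hσ]
      ring
    change β (a t (σ t) x) (a t (σ t) y) = β x y
    rw [h1]
    exact congrArg (β x) ((g t ht).symm_apply_apply y)
  let E : V →L[K] V := 1 - P - Q
  let X₀ : V →L[K] V := P * X * P + E * X * E + Q * X * Q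
  let F (t : K) : (V →L[K] V) × V :=
    (X₀ + t • (P * X * E) + (t * σ t) • (P * X * Q) + σ t • (E * X * Q), a t (σ t) v)
  have hFv (t : K) : a t (σ t) v = t • P v + (v - P v) := by simp [a, hQv]
  have hF (t : K) (ht : t ≠ 0) : F t ∈ unitaryOrbit β X v := by
    refine ⟨g t ht, hg t ht, Prod.ext ?_ rfl⟩
    have h := conj_block_triangular hPP hQQ hQP hXP hQX ht (hs0 ht)
    refine h.symm.trans ?_
    have hsymm : ((g t ht).symm : V →L[K] V) = t⁻¹ • P + (1 - P - Q) + σ t • Q := by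
      change t⁻¹ • P + (1 - P - Q) + (σ t)⁻¹⁻¹ • Q = _
      rw [inv_inv]
    rw [mul_assoc, ← hsymm]
    rfl
  have hFc : Continuous F := by
    simp only [F, hFv]
    fun_prop
  have hF0 : F 0 ∈ unitaryOrbit β X v := by
    have h1 : Filter.Tendsto F (𝓝[≠] 0) (𝓝 (F 0)) := hFc.continuousAt.mono_left nhdsWithin_le_nhds
    exact hcl.mem_of_tendsto h1 (eventually_mem_nhdsWithin.mono fun t ht => hF t ht)
  obtain ⟨k, hk, hkF⟩ := hF0
  obtain ⟨hk1, hk2⟩ := Prod.mk.inj hkF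
  simp only [map_zero, zero_smul, mul_zero, add_zero] at hk1
  rw [hFv, zero_smul, zero_add] at hk2
  let h := g (-1) (neg_ne_zero.mpr one_ne_zero)
  have hh (x : V) : h x = a (-1) (σ (-1)) x := rfl
  have hX₀ (x : V) : h (X₀ x) = X₀ (h x) :=
    congrArg (fun T : V →L[K] V => T x)
      (commute_block_diagonal hPP hQQ hPQ hQP X (-1) (σ (-1))⁻¹).eq
  have hkX := ContinuousLinearEquiv.conj_eq_iff.mp hk1
  have hfix : h (k v) = k v := by
    have hPv : P (P v) = P v := hRP _ (hPR v)
    have hQPv : Q (P v) = 0 := congrArg (fun T : V →L[K] V => T v) hQP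
    simp [hh, ← hk2, a, hPv, hQPv, hQv]
  have hone := hst ((k.trans h).trans k.symm)
    (fun x y => by
      rw [← hk]
      simp [h, hg, hk])
    (ContinuousLinearEquiv.conj_eq_iff.mpr fun x => by
      apply k.injective
      simp [hkX, hX₀]).symm
    (by simp [hfix])
  rw [Submodule.eq_bot_iff]
  intro x hx
  have hPx : P x = x := hRP x hx
  have hQx : Q x = 0 := by
    rw [← hPx]; exact congrArg (fun T : V →L[K] V => T x) hQP
  have hhx : h x = x := by
    have := congrArg (fun e : V ≃L[K] V => k (e (k.symm x))) hone
    simpa using this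
  have hneg : h x = -x := by simp [hh, a, hPx, hQx]
  have h2 : (2 : K) • x = 0 := by
    rw [two_smul, ← eq_neg_iff_add_eq_zero]; exact hhx.symm.trans hneg
  exact (smul_eq_zero.mp h2).resolve_left two_ne_zero

/-- If the orbit of `(X, v)` is closed and its stabilizer is trivial, then `v` is a cyclic vector
of `X`. -/
theorem span_eq_top_of_isClosed_unitaryOrbit [CharZero K] (hσ : ∀ d, σ (σ d) = d)
    (hσc : Continuous σ) (β : V →ₗ[K] V →ₛₗ[(σ : K →+* K)] K)
    (hherm : ∀ x y, β y x = σ (β x y)) (hnd : ∀ x, (∀ y, β x y = 0) → x = 0)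
    (X : V →L[K] V) (hX : ∀ a b, β (X a) b = -β a (X b)) (v : V)
    (hcl : IsClosed (unitaryOrbit β X v)) (hst : HasTrivialUnitaryStabilizer β X v) :
    Submodule.span K (Set.range fun i : ℕ => (X ^ i) v) = ⊤ := by
  set W := Submodule.span K (Set.range fun i : ℕ => (X ^ i) v) with hW
  have hvW : v ∈ W := Submodule.subset_span ⟨0, rfl⟩
  have hXW : ∀ x ∈ W, X x ∈ W := by
    intro x hx
    induction hx using Submodule.span_induction with
    | mem x h =>
      obtain ⟨i, rfl⟩ := h
      refine Submodule.subset_span ⟨i + 1, ?_⟩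
      simp only [pow_succ']
      rfl
    | zero => simp
    | add x y _ _ hx hy => simpa using W.add_mem hx hy
    | smul c x _ hx => simpa using W.smul_mem c hx
  let R : Submodule K V :=
    { carrier := {x | x ∈ W ∧ ∀ w ∈ W, β x w = 0}
      add_mem' := fun hx hy => ⟨W.add_mem hx.1 hy.1, fun w hw => by
        rw [map_add, LinearMap.add_apply, hx.2 w hw, hy.2 w hw, add_zero]⟩
      zero_mem' := ⟨W.zero_mem, fun w _ => by simp⟩
      smul_mem' := fun c x hx => ⟨W.smul_mem c hx.1, fun w hw => by
        rw [map_smul, LinearMap.smul_apply, hx.2 w hw, smul_zero]⟩ }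
  have hRbot : R = ⊥ :=
    eq_bot_of_isClosed_unitaryOrbit hσ hσc β hherm hnd X hX v hcl hst R
      (fun x hx y hy => hx.2 y hy.1)
      (fun x hx => ⟨hXW x hx.1, fun w hw => by rw [hX, hx.2 _ (hXW w hw), neg_zero]⟩)
      (fun x hx => hx.2 v hvW)
  have hndW : ∀ x ∈ W, (∀ w ∈ W, β x w = 0) → x = 0 := fun x hx h => by
    have : x ∈ R := ⟨hx, h⟩
    rwa [hRbot, Submodule.mem_bot] at this
  obtain ⟨S, hS⟩ := LinearMap.exists_sesq_represent (V := W) (W := V)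
    (LinearMap.mk₂'ₛₗ (RingHom.id K) (σ : K →+* K) (fun x y : W => β x y)
      (by simp) (by simp) (by simp) (by simp))
    (fun x h => Subtype.ext (hndW x x.2 fun w hw => h ⟨w, hw⟩))
    (LinearMap.mk₂'ₛₗ (RingHom.id K) (σ : K →+* K) (fun (x : V) (y : W) => β x y)
      (by simp) (by simp) (by simp) (by simp))
  let p : V →ₗ[K] V := W.subtype ∘ₗ S
  have hpW : ∀ x, p x ∈ W := fun x => (S x).2
  have hp : ∀ x, ∀ w ∈ W, β (p x) w = β x w := fun x w hw => hS x ⟨w, hw⟩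
  have hp' : ∀ x, ∀ w ∈ W, β w (p x) = β w x := fun x w hw => by
    rw [hherm (p x), hp x w hw, ← hherm]
  have hpu : ∀ x, ∀ y ∈ W, (∀ w ∈ W, β y w = β x w) → p x = y := fun x y hy h => by
    rw [← sub_eq_zero]
    refine hndW _ (W.sub_mem (hpW x) hy) fun w hw => ?_
    rw [map_sub, LinearMap.sub_apply, hp x w hw, h w hw, sub_self]
  have hpid : ∀ x ∈ W, p x = x := fun x hx => hpu x x hx fun _ _ => rfl
  have hpX : ∀ x, p (X x) = X (p x) := fun x =>
    hpu _ _ (hXW _ (hpW x)) fun w hw => by rw [hX, hX, hp _ _ (hXW w hw)]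
  -- the orthogonal reflection through `W` stabilizes `(X, v)`
  let r : V →ₗ[K] V := (2 : K) • p - LinearMap.id
  have hr : ∀ x, r x = (2 : K) • p x - x := fun x => rfl
  have hrr : ∀ x, r (r x) = x := fun x => by
    rw [hr (r x), hr, map_sub, map_smul, hpid _ (hpW x)]
    module
  let g : V ≃L[K] V := (LinearEquiv.ofInvolutive r hrr).toContinuousLinearEquiv
  have hg : ∀ x, g x = (2 : K) • p x - x := fun x => rfl
  have hone := hst g
    (fun x y => by
      simp only [hg, map_sub, LinearMap.sub_apply, map_smul, LinearMap.smul_apply,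
        LinearMap.map_smulₛₗ, hp x _ (hpW y)]
      have h1 : β (p x) y = β x (p y) := by rw [← hp' y _ (hpW x), hp x _ (hpW y)]
      simp only [h1, map_ofNat, smul_eq_mul]
      ring)
    (ContinuousLinearEquiv.conj_eq_iff.mpr fun x => by simp [hg, hpX]).symm
    (by rw [hg, hpid v hvW, two_smul, add_sub_cancel_right])
  rw [eq_top_iff]
  intro x _
  have h1 : (2 : K) • p x - x = x := congrArg (fun e : V ≃L[K] V => e x) hone
  have h2 : x = p x := by
    rw [sub_eq_iff_eq_add, ← two_smul K x] at h1
    exact (smul_right_injective V (two_ne_zero' K) h1).symm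
  rw [h2]
  exact hpW x

end SesquilinearTopology

/-- Over a non-archimedean local field `D` of characteristic `0` with continuous
involution, let `⟨·,·⟩` be a nondegenerate hermitian form on the `n`-dimensional space
`V`, `G` its unitary group, and `X` a skew-adjoint endomorphism, `v ∈ V`.  Then `(X, v)`
is regular (i.e. `(v, Xv, …, X^{n−1}v)` is a basis of `V`) if and only if its `G`-orbit
is closed in `End(V) × V` and its stabilizer in `G` is trivial. -/
theorem statement15 {D : Type*} [NontriviallyNormedField D] [CompleteSpace D]
    [LocallyCompactSpace D] [TotallyDisconnectedSpace D] [CharZero D]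
    {V : Type*} [NormedAddCommGroup V] [NormedSpace D V] [FiniteDimensional D V]
    {n : ℕ} (hn : 1 ≤ n) (hdim : Module.finrank D V = n)
    (σ : D ≃+* D) (hσ : ∀ d : D, σ (σ d) = d) (hσc : Continuous σ)
    (B : V → V → D)
    (hB1 : ∀ v v' w : V, B (v + v') w = B v w + B v' w)
    (hB2 : ∀ v w w' : V, B v (w + w') = B v w + B v w')
    (hB3 : ∀ (d d' : D) (v w : V), B (d • v) (d' • w) = d * σ d' * B v w)
    (hB4 : ∀ v w : V, B w v = σ (B v w))
    (hBnd : ∀ v : V, (∀ w : V, B v w = 0) → v = 0)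
    (X : V →L[D] V) (hX : ∀ a b : V, B (X a) b = - B a (X b)) (v : V) :
    (LinearIndependent D (fun i : Fin n => (X ^ (i : ℕ)) v) ∧
        Submodule.span D (Set.range fun i : Fin n => (X ^ (i : ℕ)) v) = ⊤) ↔
      (IsClosed {p : (V →L[D] V) × V |
          ∃ g : V ≃L[D] V, (∀ a b : V, B (g a) (g b) = B a b) ∧
            p = ((g : V →L[D] V).comp (X.comp (g.symm : V →L[D] V)), g v)} ∧
        ∀ g : V ≃L[D] V, (∀ a b : V, B (g a) (g b) = B a b) →
          (g : V →L[D] V).comp (X.comp (g.symm : V →L[D] V)) = X → g v = v →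
            g = ContinuousLinearEquiv.refl D V) := by
  let β : V →ₗ[D] V →ₛₗ[(σ : D →+* D)] D :=
    LinearMap.mk₂'ₛₗ (RingHom.id D) (σ : D →+* D) B hB1
      (fun c x y => by simpa using hB3 c 1 x y) hB2
      (fun c x y => by simpa using hB3 1 c x y)
  have hpow (i : ℕ) : ((X : Module.End D V) ^ i) v = (X ^ i) v := by
    rw [← ContinuousLinearMap.toLinearMap_pow]; rfl
  have hreg := linearIndependent_and_span_pow_iff hdim (X : Module.End D V) v
  simp only [hpow] at hreg
  rw [hreg]
  constructor
  · intro h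
    exact ⟨isClosed_unitaryOrbit_of_span hσc β hBnd X v h,
      hasTrivialUnitaryStabilizer_of_span β X v h⟩
  · rintro ⟨hcl, hst⟩
    exact span_eq_top_of_isClosed_unitaryOrbit hσ hσc β hB4 hBnd X hX v hcl hst
end
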